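/- arXiv:2312.15110 — 2 statements merged into one kernel-verified Lean document; each statement's English description precedes it below -/
import Mathlib

section
/- Let (M,τ) be a tracial von Neumann algebra and 𝒜 a von Neumann algebra with M ⊂ 𝒜. There exists an (M,τ)-hypertrace on 𝒜 if and only if there exists a conditional expectation from 𝒜 onto M; moreover, there exists a normal hypertrace on 𝒜 if and only if there exists a normal conditional expectation from 𝒜 onto M. -/
open scoped InnerProductSpace ComplexOrder ENNReal
open Filter Topology

set_option synthInstance.maxHeartbeats 400000
set_option maxHeartbeats 1000000

noncomputable section

namespace Paper

instance (priority := 100) {H : Type} [NormedAddCommGroup H] [InnerProductSpace ℂ H]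
    [CompleteSpace H] (M : VonNeumannAlgebra H) : Algebra ℂ M :=
  inferInstanceAs (Algebra ℂ M.toStarSubalgebra)

variable {H : Type} [NormedAddCommGroup H] [InnerProductSpace ℂ H] [CompleteSpace H]

/-! ### States on a von Neumann algebra -/

section States

variable (M : VonNeumannAlgebra H)

/-- A state on a von Neumann algebra: a unital positive linear functional. -/
def IsStateOn (φ : M →ₗ[ℂ] ℂ) : Prop :=
  φ 1 = 1 ∧ ∀ x : M, 0 ≤ φ (star x * x)

/-- A linear functional on a (concretely represented) von Neumann algebra is normal iff it is
a countable sum of vector functionals. -/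
def IsNormalOn (φ : M →ₗ[ℂ] ℂ) : Prop :=
  ∃ ξ : ℕ → H, Summable (fun k => ‖ξ k‖ ^ 2) ∧
    ∀ x : M, HasSum (fun k => ⟪ξ k, (x : H →L[ℂ] H) (ξ k)⟫_ℂ) (φ x)

def IsFaithfulOn (φ : M →ₗ[ℂ] ℂ) : Prop := ∀ x : M, φ (star x * x) = 0 → x = 0

def IsTracialOn (φ : M →ₗ[ℂ] ℂ) : Prop := ∀ x y : M, φ (x * y) = φ (y * x)

def IsFactor : Prop := ∀ x : M, (∀ y : M, x * y = y * x) → ∃ c : ℂ, x = c • (1 : M)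

def IsUnitaryEl (u : M) : Prop := star u * u = 1 ∧ u * star u = 1

/-- A `II₁` factor: an infinite-dimensional factor with a faithful normal tracial state. -/
structure IsII1Factor (τ : M →ₗ[ℂ] ℂ) : Prop where
  factor : IsFactor M
  state : IsStateOn M τ
  normal : IsNormalOn M τ
  tracial : IsTracialOn M τ
  faithful : IsFaithfulOn M τ
  infDim : ¬ FiniteDimensional ℂ M

/-- A net of unitaries of `M` converging weakly to `0`. -/
def WOTNullNet {ι : Type} (F : Filter ι) (u : ι → M) : Prop :=
  ∀ v w : H, Tendsto (fun i => ⟪v, ((u i : M) : H →L[ℂ] H) w⟫_ℂ) F (𝓝 (0 : ℂ))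

end States

/-! ### Representations and bimodules -/

variable {L : Type} [NormedAddCommGroup L] [InnerProductSpace ℂ L] [CompleteSpace L]

/-- A unital *-representation (no normality assumption). -/
structure Rep₀ (M : VonNeumannAlgebra H) (L : Type) [NormedAddCommGroup L]
    [InnerProductSpace ℂ L] [CompleteSpace L] where
  ρ : M → (L →L[ℂ] L)
  map_add : ∀ x y, ρ (x + y) = ρ x + ρ y
  map_smul : ∀ (c : ℂ) x, ρ (c • x) = c • ρ x
  map_mul : ∀ x y, ρ (x * y) = ρ x * ρ y
  map_one : ρ 1 = 1
  map_star : ∀ x, ρ (star x) = ContinuousLinearMap.adjoint (ρ x)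

/-- Normality of a map into `B(L)`: all its vector functionals are normal on `M`. -/
def RepNormal (M : VonNeumannAlgebra H) (ρ : M → (L →L[ℂ] L)) : Prop :=
  ∀ ξ : L, ∃ η : ℕ → H, Summable (fun k => ‖η k‖ ^ 2) ∧
    ∀ x : M, HasSum (fun k => ⟪η k, (x : H →L[ℂ] H) (η k)⟫_ℂ) ⟪ξ, ρ x ξ⟫_ℂ

/-- A normal unital *-representation. -/
structure Rep (M : VonNeumannAlgebra H) (L : Type) [NormedAddCommGroup L]
    [InnerProductSpace ℂ L] [CompleteSpace L] extends Rep₀ M L where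
  normal : RepNormal M ρ

/-- A normal unital *-antirepresentation (for right actions). -/
structure AntiRep (M : VonNeumannAlgebra H) (L : Type) [NormedAddCommGroup L]
    [InnerProductSpace ℂ L] [CompleteSpace L] where
  ρ : M → (L →L[ℂ] L)
  map_add : ∀ x y, ρ (x + y) = ρ x + ρ y
  map_smul : ∀ (c : ℂ) x, ρ (c • x) = c • ρ x
  map_mul : ∀ x y, ρ (x * y) = ρ y * ρ x
  map_one : ρ 1 = 1
  map_star : ∀ x, ρ (star x) = ContinuousLinearMap.adjoint (ρ x)
  normal : RepNormal M ρ

/-- A (normal) Hilbert `M`-bimodule structure on `L`. -/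
structure Bimodule (M : VonNeumannAlgebra H) (L : Type) [NormedAddCommGroup L]
    [InnerProductSpace ℂ L] [CompleteSpace L] where
  l : Rep M L
  r : AntiRep M L
  comm : ∀ x y, l.ρ x * r.ρ y = r.ρ y * l.ρ x

namespace Bimodule

variable {M : VonNeumannAlgebra H} (b : Bimodule M L)

/-- A central vector: `xξ = ξx` for all `x ∈ M`. -/
def IsCentralVec (ξ : L) : Prop := ∀ x : M, b.l.ρ x ξ = b.r.ρ x ξ

/-- A net of `M`-almost central unit vectors. -/
def HasAlmostCentralUnitVecs : Prop :=
  ∃ (ι : Type) (F : Filter ι), F.NeBot ∧ ∃ ξ : ι → L, (∀ i, ‖ξ i‖ = 1) ∧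
    ∀ x : M, Tendsto (fun i => ‖b.l.ρ x (ξ i) - b.r.ρ x (ξ i)‖) F (𝓝 0)

def LeftTracialVec (τ : M →ₗ[ℂ] ℂ) (ξ : L) : Prop := ∀ x : M, ⟪ξ, b.l.ρ x ξ⟫_ℂ = τ x

def RightTracialVec (τ : M →ₗ[ℂ] ℂ) (ξ : L) : Prop := ∀ x : M, ⟪ξ, b.r.ρ x ξ⟫_ℂ = τ x

/-- `sup_{y ∈ (M)₁} |⟨u ξ y, η⟩|`. -/
def mixSupL (u : M) (ξ η : L) : ℝ :=
  ⨆ y : {y : M // ‖(y : H →L[ℂ] H)‖ ≤ 1}, ‖⟪η, b.l.ρ u (b.r.ρ y.1 ξ)⟫_ℂ‖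

/-- `sup_{y ∈ (M)₁} |⟨y ξ u, η⟩|`. -/
def mixSupR (u : M) (ξ η : L) : ℝ :=
  ⨆ y : {y : M // ‖(y : H →L[ℂ] H)‖ ≤ 1}, ‖⟪η, b.r.ρ u (b.l.ρ y.1 ξ)⟫_ℂ‖

def LeftMixing : Prop :=
  ∀ (ι : Type) (F : Filter ι) (u : ι → M), F.NeBot → (∀ i, IsUnitaryEl M (u i)) →
    WOTNullNet M F u →
    ∀ ξ η : L, Tendsto (fun i => b.mixSupL (u i) ξ η) F (𝓝 0)

def RightMixing : Prop :=
  ∀ (ι : Type) (F : Filter ι) (u : ι → M), F.NeBot → (∀ i, IsUnitaryEl M (u i)) →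
    WOTNullNet M F u →
    ∀ ξ η : L, Tendsto (fun i => b.mixSupR (u i) ξ η) F (𝓝 0)

def Mixing : Prop := b.LeftMixing ∧ b.RightMixing

def LeftWeaklyMixing : Prop :=
  ∃ (ι : Type) (F : Filter ι), F.NeBot ∧ ∃ u : ι → M, (∀ i, IsUnitaryEl M (u i)) ∧
    ∀ ξ η : L, Tendsto (fun i => b.mixSupL (u i) ξ η) F (𝓝 0)

def RightWeaklyMixing : Prop :=
  ∃ (ι : Type) (F : Filter ι), F.NeBot ∧ ∃ u : ι → M, (∀ i, IsUnitaryEl M (u i)) ∧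
    ∀ ξ η : L, Tendsto (fun i => b.mixSupR (u i) ξ η) F (𝓝 0)

def WeaklyMixing : Prop := b.LeftWeaklyMixing ∧ b.RightWeaklyMixing

end Bimodule

/-- A bundled Hilbert `M`-bimodule. -/
structure BimoduleSpace (M : VonNeumannAlgebra H) where
  carrier : Type
  [nacg : NormedAddCommGroup carrier]
  [ips : InnerProductSpace ℂ carrier]
  [cs : CompleteSpace carrier]
  bm : Bimodule M carrier

attribute [instance] BimoduleSpace.nacg BimoduleSpace.ips BimoduleSpace.cs

/-- Property (T): every `M`-bimodule with almost central unit vectors has a nonzero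
central vector. -/
def HasPropertyT (M : VonNeumannAlgebra H) : Prop :=
  ∀ X : BimoduleSpace M, X.bm.HasAlmostCentralUnitVecs →
    ∃ ξ : X.carrier, ξ ≠ 0 ∧ X.bm.IsCentralVec ξ

/-- The Haagerup property: `M` admits a mixing bimodule with almost central unit vectors. -/
def HasHaagerup (M : VonNeumannAlgebra H) : Prop :=
  ∃ X : BimoduleSpace M, X.bm.Mixing ∧ X.bm.HasAlmostCentralUnitVecs

end Paper

namespace Paper

variable {H : Type} [NormedAddCommGroup H] [InnerProductSpace ℂ H] [CompleteSpace H]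

/-! ### Inclusions of von Neumann algebras -/

/-- A normal unital embedding `M ⊆ 𝒜` of von Neumann algebras. -/
structure Inclusion (M : VonNeumannAlgebra H) {K : Type} [NormedAddCommGroup K]
    [InnerProductSpace ℂ K] [CompleteSpace K] (A : VonNeumannAlgebra K) where
  π : M →ₗ[ℂ] A
  map_one : π 1 = 1
  map_mul : ∀ x y, π (x * y) = π x * π y
  map_star : ∀ x, π (star x) = star (π x)
  inj : Function.Injective π
  normal : ∀ φ : A →ₗ[ℂ] ℂ, IsStateOn A φ → IsNormalOn A φ → IsNormalOn M (φ ∘ₗ π)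

section Hyperstates

variable {M : VonNeumannAlgebra H} {K : Type} [NormedAddCommGroup K]
  [InnerProductSpace ℂ K] [CompleteSpace K] {A : VonNeumannAlgebra K}

/-- A `τ`-hyperstate on `𝒜`: a state restricting to `τ` on `M`. -/
def IsHyperstate (τ : M →ₗ[ℂ] ℂ) (inc : Inclusion M A) (ψ : A →ₗ[ℂ] ℂ) : Prop :=
  IsStateOn A ψ ∧ ∀ x : M, ψ (inc.π x) = τ x

/-- An `(M,τ)`-hypertrace on `𝒜`: a hyperstate with `ψ(xT) = ψ(Tx)` for `x ∈ M`. -/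
def IsHypertrace (τ : M →ₗ[ℂ] ℂ) (inc : Inclusion M A) (ψ : A →ₗ[ℂ] ℂ) : Prop :=
  IsHyperstate τ inc ψ ∧ ∀ (x : M) (T : A), ψ (inc.π x * T) = ψ (T * inc.π x)

/-- A conditional expectation from `𝒜` onto `M`. -/
structure CondExp (inc : Inclusion M A) where
  E : A →ₗ[ℂ] M
  map_one : E 1 = 1
  pos : ∀ T : A, ((E (star T * T) : M) : H →L[ℂ] H).IsPositive
  bimod : ∀ (x y : M) (T : A), E (inc.π x * T * inc.π y) = x * E T * y
  retract : ∀ x : M, E (inc.π x) = x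

/-- Normality for a conditional expectation. -/
def CondExp.IsNormal {inc : Inclusion M A} (CE : CondExp inc) : Prop :=
  ∀ φ : M →ₗ[ℂ] ℂ, IsStateOn M φ → IsNormalOn M φ → IsNormalOn A (φ ∘ₗ CE.E)

end Hyperstates

/-! ### Standard forms -/

/-- The Haagerup standard form `(𝒜, L²(𝒜), J, L²(𝒜)₊)` of a von Neumann algebra. -/
structure StandardForm {K : Type} [NormedAddCommGroup K] [InnerProductSpace ℂ K]
    [CompleteSpace K] (A : VonNeumannAlgebra K) (L : Type) [NormedAddCommGroup L]
    [InnerProductSpace ℂ L] [CompleteSpace L] where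
  rep : Rep A L
  J : L → L
  J_add : ∀ v w, J (v + w) = J v + J w
  J_smul : ∀ (c : ℂ) v, J (c • v) = (starRingEnd ℂ) c • J v
  J_inner : ∀ v w, ⟪J v, J w⟫_ℂ = ⟪w, v⟫_ℂ
  J_invol : ∀ v, J (J v) = v
  cone : Set L
  J_fix : ∀ v ∈ cone, J v = v
  cone_pos : ∀ v ∈ cone, ∀ w ∈ cone, 0 ≤ (⟪v, w⟫_ℂ).re ∧ (⟪v, w⟫_ℂ).im = 0
  commutant : ∀ (T S : A) (v : L), rep.ρ T (J (rep.ρ S (J v))) = J (rep.ρ S (J (rep.ρ T v)))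
  vec : ∀ ψ : A →ₗ[ℂ] ℂ, IsStateOn A ψ → IsNormalOn A ψ →
    ∃! ξ : L, ξ ∈ cone ∧ ∀ T : A, ψ T = ⟪ξ, rep.ρ T ξ⟫_ℂ

namespace StandardForm

variable {K : Type} [NormedAddCommGroup K] [InnerProductSpace ℂ K] [CompleteSpace K]
  {A : VonNeumannAlgebra K} {L : Type} [NormedAddCommGroup L] [InnerProductSpace ℂ L]
  [CompleteSpace L]

/-- The canonical right action `ξ ↦ ξT = J T* J ξ` on the standard form. -/
def rmul (sf : StandardForm A L) (T : A) (v : L) : L := sf.J (sf.rep.ρ (star T) (sf.J v))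

/-- Compatibility of an `M`-bimodule structure on `L²(𝒜)` with the standard form of `𝒜`,
for an inclusion `M ⊆ 𝒜`: the left action comes from the representation of `𝒜` and the
right action from `J (·)* J`. -/
def Compat {M : VonNeumannAlgebra H} (sf : StandardForm A L) (inc : Inclusion M A)
    (b : Bimodule M L) : Prop :=
  (∀ x : M, b.l.ρ x = sf.rep.ρ (inc.π x)) ∧
  (∀ (x : M) (v : L), b.r.ρ x v = sf.rmul (inc.π x) v)

end StandardForm

/-- A bundled inclusion `M ⊆ 𝒜` of von Neumann algebras (with `𝒜` separable), together
with a standard form of `𝒜`. -/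
structure InclusionData (M : VonNeumannAlgebra H) where
  K : Type
  [nacgK : NormedAddCommGroup K]
  [ipsK : InnerProductSpace ℂ K]
  [csK : CompleteSpace K]
  sepK : TopologicalSpace.SeparableSpace K
  A : VonNeumannAlgebra K
  inc : Inclusion M A
  L : Type
  [nacgL : NormedAddCommGroup L]
  [ipsL : InnerProductSpace ℂ L]
  [csL : CompleteSpace L]
  sf : StandardForm A L

attribute [instance] InclusionData.nacgK InclusionData.ipsK InclusionData.csK
attribute [instance] InclusionData.nacgL InclusionData.ipsL InclusionData.csL

end Paper

namespace Paper

variable {H : Type} [NormedAddCommGroup H] [InnerProductSpace ℂ H] [CompleteSpace H]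

/-! ### The GNS representation `L²(M,τ)` and hyperstates on `B(L²(M))` -/

/-- The GNS (standard) representation of `(M,τ)` on `L²(M,τ)`. -/
structure GNSRep (M : VonNeumannAlgebra H) (τ : M →ₗ[ℂ] ℂ) (L2M : Type)
    [NormedAddCommGroup L2M] [InnerProductSpace ℂ L2M] [CompleteSpace L2M] where
  rep : Rep M L2M
  Ω : L2M
  cyclic : Dense (↑(Submodule.span ℂ (Set.range fun x : M => rep.ρ x Ω)) : Set L2M)
  repr : ∀ x : M, τ x = ⟪Ω, rep.ρ x Ω⟫_ℂ

section BL2M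

variable {M : VonNeumannAlgebra H} {L2M : Type} [NormedAddCommGroup L2M]
  [InnerProductSpace ℂ L2M] [CompleteSpace L2M]

/-- A state on all of `B(L²(M))`. -/
def IsStateB (φ : (L2M →L[ℂ] L2M) →ₗ[ℂ] ℂ) : Prop :=
  φ 1 = 1 ∧ ∀ T : L2M →L[ℂ] L2M, 0 ≤ φ (star T * T)

/-- A normal functional on `B(L²(M))` (a countable sum of vector functionals). -/
def IsNormalB (φ : (L2M →L[ℂ] L2M) →ₗ[ℂ] ℂ) : Prop :=
  ∃ ξ : ℕ → L2M, Summable (fun k => ‖ξ k‖ ^ 2) ∧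
    ∀ T : L2M →L[ℂ] L2M, HasSum (fun k => ⟪ξ k, T (ξ k)⟫_ℂ) (φ T)

/-- A `τ`-hyperstate on `B(L²(M))`. -/
def IsHyperstateB (τ : M →ₗ[ℂ] ℂ) (gns : GNSRep M τ L2M)
    (φ : (L2M →L[ℂ] L2M) →ₗ[ℂ] ℂ) : Prop :=
  IsStateB φ ∧ ∀ x : M, φ (gns.rep.ρ x) = τ x

/-- `∑ₙ zₙ* zₙ = 1` (in the strong sense). -/
def SumsToOne (z : ℕ → M) : Prop :=
  ∀ v : H, HasSum (fun n => ⟪((z n : M) : H →L[ℂ] H) v, ((z n : M) : H →L[ℂ] H) v⟫_ℂ) ⟪v, v⟫_ℂ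

/-- The standard form `φ = ∑ₙ ⟨· ẑₙ*, ẑₙ*⟩` of a normal hyperstate on `B(L²(M))`. -/
def IsStdFormOf (τ : M →ₗ[ℂ] ℂ) (gns : GNSRep M τ L2M)
    (φ : (L2M →L[ℂ] L2M) →ₗ[ℂ] ℂ) (z : ℕ → M) : Prop :=
  SumsToOne z ∧
  ∀ T : L2M →L[ℂ] L2M,
    HasSum (fun n => ⟪gns.rep.ρ (star (z n)) gns.Ω, T (gns.rep.ρ (star (z n)) gns.Ω)⟫_ℂ) (φ T)

/-- Regularity: `∑ₙ zₙ* zₙ = ∑ₙ zₙ zₙ* = 1`. -/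
def IsRegularSeq (z : ℕ → M) : Prop :=
  SumsToOne z ∧ SumsToOne (fun n => star (z n))

/-- Strong generation: the unital (non-*) algebra generated by `{zₙ}` is weakly dense in `M`. -/
def IsStronglyGenerating (z : ℕ → M) : Prop :=
  ∀ x : M, ∃ (ι : Type) (F : Filter ι), F.NeBot ∧
    ∃ a : ι → Algebra.adjoin ℂ (Set.range z),
      ∀ v w : H, Tendsto (fun i => ⟪v, (((a i : M) : M) : H →L[ℂ] H) w⟫_ℂ) F
        (𝓝 ⟪v, ((x : M) : H →L[ℂ] H) w⟫_ℂ)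

end BL2M

/-! ### Modular theory data and Furstenberg entropy -/

/-- The GNS space of a normal faithful hyperstate `ζ` on `𝒜`, together with the embedding of
`L²(M)`, and the spectral data of the modular operator `Δ_ζ`: `P` is its projection-valued
spectral measure, `μ ξ` the associated scalar spectral measures, `res t = (Δ_ζ + t)⁻¹`.  The
field `modular_rel` expresses `⟨Δ_ζ T Ω, T Ω⟩ = ‖T* Ω‖²`, i.e. `Δ_ζ = S* S` with
`S(TΩ) = T*Ω`. -/
structure ModularData {K : Type} [NormedAddCommGroup K] [InnerProductSpace ℂ K]
    [CompleteSpace K] {M : VonNeumannAlgebra H} {A : VonNeumannAlgebra K}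
    {L2M : Type} [NormedAddCommGroup L2M] [InnerProductSpace ℂ L2M] [CompleteSpace L2M]
    (τ : M →ₗ[ℂ] ℂ) (inc : Inclusion M A) (gns : GNSRep M τ L2M) (ζ : A →ₗ[ℂ] ℂ) where
  L : Type
  [nacg : NormedAddCommGroup L]
  [ips : InnerProductSpace ℂ L]
  [cs : CompleteSpace L]
  rep : Rep A L
  Ω : L
  cyclic : Dense (↑(Submodule.span ℂ (Set.range fun T : A => rep.ρ T Ω)) : Set L)
  state_eq : ∀ T : A, ζ T = ⟪Ω, rep.ρ T Ω⟫_ℂ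
  emb : L2M →ₗᵢ[ℂ] L
  emb_Ω : emb gns.Ω = Ω
  emb_equiv : ∀ (x : M) (v : L2M), emb (gns.rep.ρ x v) = rep.ρ (inc.π x) (emb v)
  P : Set ℝ → (L →L[ℂ] L)
  P_sa : ∀ S, IsSelfAdjoint (P S)
  P_idem : ∀ S, P S * P S = P S
  P_inter : ∀ S T : Set ℝ, MeasurableSet S → MeasurableSet T → P (S ∩ T) = P S * P T
  P_univ : P Set.univ = 1
  P_nonpos : P (Set.Iic 0) = 0
  P_sigma : ∀ S : ℕ → Set ℝ, (∀ n, MeasurableSet (S n)) → Pairwise (Function.onFun Disjoint S) →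
    ∀ ξ : L, HasSum (fun n => P (S n) ξ) (P (⋃ n, S n) ξ)
  μ : L → MeasureTheory.Measure ℝ
  μ_eq : ∀ (ξ : L) (S : Set ℝ), MeasurableSet S → μ ξ S = ENNReal.ofReal (⟪ξ, P S ξ⟫_ℂ).re
  modular_rel : ∀ T : A,
    ∫⁻ l, ENNReal.ofReal l ∂(μ (rep.ρ T Ω)) = ENNReal.ofReal (‖rep.ρ (star T) Ω‖ ^ 2)
  res : ℝ → (L →L[ℂ] L)
  res_eq : ∀ t : ℝ, 0 < t → ∀ ξ : L,
    ⟪ξ, res t ξ⟫_ℂ = ((∫ l, (l + t)⁻¹ ∂(μ ξ) : ℝ) : ℂ)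

attribute [instance] ModularData.nacg ModularData.ips ModularData.cs

variable {K : Type} [NormedAddCommGroup K] [InnerProductSpace ℂ K] [CompleteSpace K]
  {M : VonNeumannAlgebra H} {A : VonNeumannAlgebra K} {L2M : Type}
  [NormedAddCommGroup L2M] [InnerProductSpace ℂ L2M] [CompleteSpace L2M]

/-- The Furstenberg-type entropy `h_φ(𝒜,ζ) = -φ(e log Δ_ζ e)`, where the normal hyperstate
`φ = ∑ₙ ⟨· vecsₙ, vecsₙ⟩` is given by its defining sequence of vectors in `L²(M)`. -/
def fEntropy {τ : M →ₗ[ℂ] ℂ} {inc : Inclusion M A} {gns : GNSRep M τ L2M} {ζ : A →ₗ[ℂ] ℂ}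
    (md : ModularData τ inc gns ζ) (vecs : ℕ → L2M) : ℝ :=
  - ∑' n, ∫ l, Real.log l ∂(md.μ (md.emb (vecs n)))

/-- The canonical sequence of vectors `ẑₙ* = z_n^* Ω` attached to the standard form of a
normal hyperstate on `B(L²(M))`. -/
def stdVecs (gns : GNSRep M τ L2M) (z : ℕ → M) : ℕ → L2M :=
  fun n => gns.rep.ρ (star (z n)) gns.Ω

/-- The inclusion `M ⊆ 𝒜` admits vanishing Furstenberg entropy: there is a normal regular
strongly generating hyperstate `φ` on `B(L²(M))` and a net of normal faithful hyperstates
`ζᵢ` on `𝒜` with `h_φ(𝒜,ζᵢ) → 0`. -/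
def AdmitsVanishingEntropy (τ : M →ₗ[ℂ] ℂ) (inc : Inclusion M A)
    (gns : GNSRep M τ L2M) : Prop :=
  ∃ (φ : (L2M →L[ℂ] L2M) →ₗ[ℂ] ℂ) (z : ℕ → M),
    IsNormalB φ ∧ IsHyperstateB τ gns φ ∧ IsStdFormOf τ gns φ z ∧ IsRegularSeq z ∧
    IsStronglyGenerating z ∧
    ∃ (ι : Type) (F : Filter ι), F.NeBot ∧
      ∃ (ζ : ι → (A →ₗ[ℂ] ℂ)) (md : ∀ i, ModularData τ inc gns (ζ i)),
        (∀ i, IsHyperstate τ inc (ζ i) ∧ IsNormalOn A (ζ i) ∧ IsFaithfulOn A (ζ i)) ∧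
        Tendsto (fun i => fEntropy (md i) (stdVecs gns z)) F (𝓝 0)

/-- `M` has entropy gap: for every normal regular strongly generating hyperstate `φ` on
`B(L²(M))` there is `ε > 0` such that `h_φ(𝒜,ζ) > ε` for every inclusion `M ⊆ 𝒜` without
normal conditional expectation and every normal faithful hyperstate `ζ` on `𝒜`. -/
def HasEntropyGap (M : VonNeumannAlgebra H) (τ : M →ₗ[ℂ] ℂ) (gns : GNSRep M τ L2M) : Prop :=
  ∀ (φ : (L2M →L[ℂ] L2M) →ₗ[ℂ] ℂ) (z : ℕ → M),
    IsNormalB φ → IsHyperstateB τ gns φ → IsStdFormOf τ gns φ z → IsRegularSeq z →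
    IsStronglyGenerating z →
    ∃ ε : ℝ, 0 < ε ∧
      ∀ X : InclusionData M, (¬ ∃ CE : CondExp X.inc, CE.IsNormal) →
        ∀ (ζ : X.A →ₗ[ℂ] ℂ) (md : ModularData τ X.inc gns ζ),
          IsHyperstate τ X.inc ζ → IsNormalOn X.A ζ → IsFaithfulOn X.A ζ →
          ε < fEntropy md (stdVecs gns z)

end Paper

namespace Paper

section Algebra

variable {H : Type} [NormedAddCommGroup H] [InnerProductSpace ℂ H] [CompleteSpace H]
  {M : VonNeumannAlgebra H}

theorem coe_smul_vN (c : ℂ) (x : M) : ((c • x : M) : H →L[ℂ] H) = c • (x : H →L[ℂ] H) := rfl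

theorem star_smul_vN (c : ℂ) (x : M) : star (c • x) = star c • star x :=
  Subtype.ext (by simp only [coe_smul_vN, star_smul, StarMemClass.coe_star])

theorem smul_smul_vN (c d : ℂ) (x : M) : c • d • x = (c * d) • x := smul_smul c d x

theorem smul_add_vN (c : ℂ) (x y : M) : c • (x + y) = c • x + c • y := smul_add c x y

theorem mem_of_commute (x : H →L[ℂ] H) (h : ∀ y ∈ M.commutant, y * x = x * y) : x ∈ M := by
  rw [← M.commutant_commutant, VonNeumannAlgebra.mem_commutant_iff]
  exact h

theorem cfc_mem {x : H →L[ℂ] H} (hx : x ∈ M) (f : ℝ → ℝ) :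
    cfc f x ∈ M := by
  refine mem_of_commute _ fun y hy => ?_
  have hc : Commute x y := VonNeumannAlgebra.mem_commutant_iff.mp hy x hx
  exact ((hc.cfc_real f).eq).symm

theorem exists_star_mul_self_of_nonneg (x : M) (hx : 0 ≤ (x : H →L[ℂ] H)) :
    ∃ w : M, star w = w ∧ x = star w * w := by
  have hw : IsSelfAdjoint (cfc Real.sqrt (x : H →L[ℂ] H)) := cfc_predicate _ _
  refine ⟨⟨cfc Real.sqrt (x : H →L[ℂ] H), cfc_mem x.2 _⟩, Subtype.ext hw.star_eq,
    Subtype.ext ?_⟩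
  change (x : H →L[ℂ] H) = star (cfc Real.sqrt (x : H →L[ℂ] H)) * cfc Real.sqrt (x : H →L[ℂ] H)
  rw [hw.star_eq, ← cfc_mul Real.sqrt Real.sqrt (x : H →L[ℂ] H)]
  conv_lhs => rw [← cfc_id' ℝ (x : H →L[ℂ] H)]
  refine cfc_congr fun t ht => ?_
  exact (Real.mul_self_sqrt (spectrum_nonneg_of_nonneg hx ht)).symm

/-- Positivity of a linear functional. -/
def IsPosOn (M : VonNeumannAlgebra H) (f : M →ₗ[ℂ] ℂ) : Prop := ∀ x : M, 0 ≤ f (star x * x)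

theorem IsPosOn.nonneg {f : M →ₗ[ℂ] ℂ} (hf : IsPosOn M f) (x : M)
    (hx : 0 ≤ (x : H →L[ℂ] H)) : 0 ≤ f x := by
  obtain ⟨w, -, rfl⟩ := exists_star_mul_self_of_nonneg x hx
  exact hf w

theorem star_mul_self_smul_add (c : ℂ) (x y : M) :
    star (c • x + y) * (c • x + y) = (star c * c) • (star x * x) + star c • (star x * y)
      + c • (star y * x) + star y * y := by
  rw [star_add, star_smul_vN]
  simp only [add_mul, mul_add, smul_mul_assoc, mul_smul_comm, smul_add_vN, smul_smul_vN]
  rw [mul_comm c]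
  abel

theorem IsPosOn.star_mul {f : M →ₗ[ℂ] ℂ} (hf : IsPosOn M f) (x y : M) :
    f (star y * x) = star (f (star x * y)) := by
  have h1 := (Complex.nonneg_iff.mp (hf ((1 : ℂ) • x + y))).2
  have h2 := (Complex.nonneg_iff.mp (hf (Complex.I • x + y))).2
  have hx := (Complex.nonneg_iff.mp (hf x)).2
  have hy := (Complex.nonneg_iff.mp (hf y)).2
  rw [star_mul_self_smul_add] at h1 h2
  simp at h1 h2
  apply Complex.ext
  · simp; linarith
  · simp; linarith

theorem IsPosOn.map_star {f : M →ₗ[ℂ] ℂ} (hf : IsPosOn M f) (x : M) :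
    f (star x) = star (f x) := by
  simpa using hf.star_mul 1 x

theorem IsPosOn.norm_eq {f : M →ₗ[ℂ] ℂ} (hf : IsPosOn M f) (x : M) :
    f (star x * x) = ((f (star x * x)).re : ℂ) := by
  have := (Complex.nonneg_iff.mp (hf x)).2
  apply Complex.ext <;> simp [← this]

theorem IsPosOn.cauchy_schwarz {f : M →ₗ[ℂ] ℂ} (hf : IsPosOn M f) (x y : M) :
    ‖f (star x * y)‖ ^ 2 ≤ (f (star x * x)).re * (f (star y * y)).re := by
  set c := f (star x * y) with hc
  have hyx : f (star y * x) = star c := hf.star_mul x y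
  have key : ∀ t : ℝ, 0 ≤ (f (star x * x)).re * ‖c‖ ^ 2 * (t * t) + (2 * ‖c‖ ^ 2) * t
      + (f (star y * y)).re := by
    intro t
    have h := (Complex.nonneg_iff.mp (hf (((t : ℂ) * c) • x + y))).1
    rw [star_mul_self_smul_add] at h
    simp only [map_add, map_smul, smul_eq_mul, hyx, ← hc] at h
    rw [hf.norm_eq x] at h
    have hn : ‖c‖ ^ 2 = c.re * c.re + c.im * c.im := by
      rw [← Complex.normSq_eq_norm_sq, Complex.normSq_apply]
    rw [hn]
    simp at h
    linarith
  have hd := discrim_le_zero key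
  rw [discrim] at hd
  rcases eq_or_lt_of_le (sq_nonneg ‖c‖) with h0 | h0
  · rw [← h0]
    exact mul_nonneg (Complex.nonneg_iff.mp (hf x)).1 (Complex.nonneg_iff.mp (hf y)).1
  · nlinarith

end Algebra

section Amplification

variable {K : Type} [NormedAddCommGroup K]

/-- The Hilbert space `ℓ²(ℕ, K)`. -/
abbrev Ell2 (K : Type) [NormedAddCommGroup K] : Type := lp (fun _ : ℕ => K) 2

theorem memℓp_two_of_summable {ζ : ℕ → K} (h : Summable fun k => ‖ζ k‖ ^ 2) :
    Memℓp ζ 2 := by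
  refine memℓp_gen ?_
  simpa using h

/-- The element of `ℓ²(ℕ, K)` given by a square summable sequence. -/
def Ell2.mk (ζ : ℕ → K) (h : Summable fun k => ‖ζ k‖ ^ 2) : Ell2 K :=
  ⟨ζ, memℓp_two_of_summable h⟩

@[simp]
theorem Ell2.mk_apply (ζ : ℕ → K) (h : Summable fun k => ‖ζ k‖ ^ 2) (k : ℕ) :
    Ell2.mk ζ h k = ζ k := rfl

theorem Ell2.hasSum_norm_sq (w : Ell2 K) : HasSum (fun k => ‖w k‖ ^ 2) (‖w‖ ^ 2) := by
  simpa using lp.hasSum_norm (p := 2) (by simp) w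

variable [InnerProductSpace ℂ K]

theorem summable_norm_sq_apply (x : K →L[ℂ] K) {ζ : ℕ → K} (h : Summable fun k => ‖ζ k‖ ^ 2) :
    Summable fun k => ‖x (ζ k)‖ ^ 2 := by
  refine Summable.of_nonneg_of_le (fun _ => by positivity) (fun k => ?_) (h.mul_left (‖x‖ ^ 2))
  rw [← mul_pow]
  gcongr
  exact x.le_opNorm _

/-- The amplification `x ⊗ 1` of `x` to `ℓ²(ℕ, K)`. -/
def amp (x : K →L[ℂ] K) : Ell2 K →L[ℂ] Ell2 K :=
  LinearMap.mkContinuous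
    { toFun := fun w => Ell2.mk (fun k => x (w k)) (summable_norm_sq_apply x w.hasSum_norm_sq.summable)
      map_add' := fun v w => by ext k; simp
      map_smul' := fun c w => by ext k; simp } ‖x‖ fun w => by
    refine le_of_sq_le_sq ?_ (by positivity)
    rw [mul_pow]
    refine hasSum_le (fun k => ?_) (Ell2.hasSum_norm_sq _) (w.hasSum_norm_sq.mul_left (‖x‖ ^ 2))
    rw [← mul_pow]
    simp only [LinearMap.coe_mk, AddHom.coe_mk, Ell2.mk_apply]
    gcongr
    exact x.le_opNorm _

@[simp]
theorem amp_apply (x : K →L[ℂ] K) (w : Ell2 K) (k : ℕ) : amp x w k = x (w k) := rfl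

theorem amp_mul (x y : K →L[ℂ] K) (w : Ell2 K) : amp (x * y) w = amp x (amp y w) := by ext k; simp

theorem hasSum_inner_amp (x : K →L[ℂ] K) (v w : Ell2 K) :
    HasSum (fun k => ⟪v k, x (w k)⟫_ℂ) ⟪v, amp x w⟫_ℂ := lp.hasSum_inner v (amp x w)

variable [CompleteSpace K]

theorem inner_amp_left (x : K →L[ℂ] K) (v w : Ell2 K) :
    ⟪amp x v, w⟫_ℂ = ⟪v, amp (star x) w⟫_ℂ := by
  refine (lp.hasSum_inner (amp x v) w).unique ?_
  have h := hasSum_inner_amp (star x) v w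
  simp only [ContinuousLinearMap.star_eq_adjoint, ContinuousLinearMap.adjoint_inner_right] at h
  exact h

/-- The orbit map `x ↦ (x ⊗ 1) Z` of a vector `Z ∈ ℓ²(ℕ, K)`. -/
def orbit (A : VonNeumannAlgebra K) (Z : Ell2 K) : A →ₗ[ℂ] Ell2 K where
  toFun x := amp (x : K →L[ℂ] K) Z
  map_add' x y := by ext k; simp
  map_smul' c x := by ext k; simp [coe_smul_vN]

theorem orbit_apply (A : VonNeumannAlgebra K) (Z : Ell2 K) (x : A) :
    orbit A Z x = amp (x : K →L[ℂ] K) Z := rfl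

theorem inner_orbit (A : VonNeumannAlgebra K) (Z : Ell2 K) (x y : A) :
    ⟪orbit A Z x, orbit A Z y⟫_ℂ = ⟪Z, orbit A Z (star x * y)⟫_ℂ := by
  simp only [orbit_apply]
  rw [inner_amp_left, ← amp_mul]
  rfl

/-- The cyclic subspace generated by a vector `Z ∈ ℓ²(ℕ, K)`. -/
def cyclicSubspace (A : VonNeumannAlgebra K) (Z : Ell2 K) : Submodule ℂ (Ell2 K) :=
  (LinearMap.range (orbit A Z)).topologicalClosure

instance (A : VonNeumannAlgebra K) (Z : Ell2 K) : CompleteSpace (cyclicSubspace A Z) :=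
  (Submodule.isClosed_topologicalClosure _).completeSpace_coe

/-- The orbit map, with values in the cyclic subspace. -/
def cyclicOrbit (A : VonNeumannAlgebra K) (Z : Ell2 K) : A →ₗ[ℂ] cyclicSubspace A Z :=
  (orbit A Z).codRestrict _ fun x =>
    Submodule.le_topologicalClosure _ (LinearMap.mem_range_self _ x)

theorem denseRange_cyclicOrbit (A : VonNeumannAlgebra K) (Z : Ell2 K) :
    DenseRange (cyclicOrbit A Z) := by
  rw [DenseRange, Subtype.dense_iff]
  intro w hw
  refine closure_mono ?_ hw
  rintro _ ⟨x, rfl⟩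
  exact ⟨_, ⟨x, rfl⟩, rfl⟩

theorem inner_cyclicOrbit (A : VonNeumannAlgebra K) (Z : Ell2 K) (x y : A) :
    ⟪cyclicOrbit A Z x, cyclicOrbit A Z y⟫_ℂ = ⟪Z, orbit A Z (star x * y)⟫_ℂ :=
  inner_orbit A Z x y

theorem norm_sq_cyclicOrbit (A : VonNeumannAlgebra K) (Z : Ell2 K) (x : A) :
    ‖cyclicOrbit A Z x‖ ^ 2 = (⟪Z, orbit A Z (star x * x)⟫_ℂ).re := by
  rw [← inner_cyclicOrbit]
  exact (inner_self_eq_norm_sq (𝕜 := ℂ) _).symm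

/-- The representation of `A` on the cyclic subspace. -/
def cyclicRep (A : VonNeumannAlgebra K) (Z : Ell2 K) (x : A) :
    cyclicSubspace A Z →L[ℂ] cyclicSubspace A Z :=
  ((amp (x : K →L[ℂ] K)).comp (cyclicSubspace A Z).subtypeL).codRestrict _ fun w => by
    refine map_mem_closure (t := LinearMap.range (orbit A Z))
      (amp (x : K →L[ℂ] K)).continuous w.2 ?_
    rintro _ ⟨y, rfl⟩
    exact ⟨x * y, amp_mul _ _ _⟩

theorem cyclicRep_cyclicOrbit (A : VonNeumannAlgebra K) (Z : Ell2 K) (x y : A) :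
    cyclicRep A Z x (cyclicOrbit A Z y) = cyclicOrbit A Z (x * y) :=
  Subtype.ext (amp_mul _ _ _).symm

theorem inner_cyclicRep_left (A : VonNeumannAlgebra K) (Z : Ell2 K) (x : A)
    (v w : cyclicSubspace A Z) : ⟪cyclicRep A Z x v, w⟫_ℂ = ⟪v, cyclicRep A Z (star x) w⟫_ℂ :=
  inner_amp_left _ _ _

/-- A functional dominated by a vector functional is represented by a Hilbert space vector. -/
theorem exists_inner_cyclicOrbit_eq (A : VonNeumannAlgebra K) (Z : Ell2 K) (f : A →ₗ[ℂ] ℂ)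
    (C : ℝ) (h : ∀ x, ‖f x‖ ≤ C * ‖cyclicOrbit A Z x‖) :
    ∃ p : cyclicSubspace A Z, ‖p‖ ≤ max C 0 ∧ ∀ x, ⟪p, cyclicOrbit A Z x⟫_ℂ = f x := by
  refine ⟨(InnerProductSpace.toDual ℂ _).symm (f.extendOfNorm (cyclicOrbit A Z)), ?_, fun x => ?_⟩
  · rw [LinearIsometryEquiv.norm_map]
    refine LinearMap.opNorm_extendOfNorm_le (denseRange_cyclicOrbit A Z) (le_max_right _ _)
      fun x => (h x).trans ?_
    gcongr
    exact le_max_left _ _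
  · rw [InnerProductSpace.toDual_symm_apply]
    exact LinearMap.extendOfNorm_eq (denseRange_cyclicOrbit A Z) ⟨C, h⟩ x

theorem cyclicSubspace_ext {A : VonNeumannAlgebra K} {Z : Ell2 K} {v w : cyclicSubspace A Z}
    (h : ∀ x, ⟪v, cyclicOrbit A Z x⟫_ℂ = ⟪w, cyclicOrbit A Z x⟫_ℂ) : v = w :=
  (denseRange_cyclicOrbit A Z).eq_of_inner_left ℂ h

end Amplification

section Domination

variable {K : Type} [NormedAddCommGroup K] [InnerProductSpace ℂ K] [CompleteSpace K]
  {A : VonNeumannAlgebra K}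

theorem exists_selfAdjoint_sqrt {E : Type} [NormedAddCommGroup E] [InnerProductSpace ℂ E]
    [CompleteSpace E] {t : E →L[ℂ] E} (ht : 0 ≤ t) :
    ∃ s : E →L[ℂ] E, IsSelfAdjoint s ∧ s * s = t ∧ ∀ y, Commute t y → Commute s y := by
  refine ⟨cfc Real.sqrt t, cfc_predicate _ _, ?_, fun y hy => hy.cfc_real Real.sqrt⟩
  rw [← cfc_mul Real.sqrt Real.sqrt t]
  conv_rhs => rw [← cfc_id' ℝ t]
  exact cfc_congr fun r hr => Real.mul_self_sqrt (spectrum_nonneg_of_nonneg ht hr)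

/-- A positive functional dominated by the vector functional of `Z` is represented by a positive
operator on the cyclic subspace of `Z`. -/
theorem IsPosOn.exists_operator {f : A →ₗ[ℂ] ℂ} (hf : IsPosOn A f) (Z : Ell2 K)
    (h : ∀ x, (f (star x * x)).re ≤ ‖cyclicOrbit A Z x‖ ^ 2) :
    ∃ t : cyclicSubspace A Z →L[ℂ] cyclicSubspace A Z,
      ∀ x y, ⟪t (cyclicOrbit A Z x), cyclicOrbit A Z y⟫_ℂ = f (star x * y) := by
  have hb : ∀ x y, ‖f (star x * y)‖ ≤ ‖cyclicOrbit A Z x‖ * ‖cyclicOrbit A Z y‖ := fun x y => by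
    refine le_of_sq_le_sq ?_ (by positivity)
    rw [mul_pow]
    exact (hf.cauchy_schwarz x y).trans
      (mul_le_mul (h x) (h y) (Complex.nonneg_iff.mp (hf y)).1 (by positivity))
  have hp : ∀ x, ∃ p : cyclicSubspace A Z, ‖p‖ ≤ ‖cyclicOrbit A Z x‖ ∧
      ∀ y, ⟪p, cyclicOrbit A Z y⟫_ℂ = f (star x * y) := fun x => by
    obtain ⟨p, h1, h2⟩ := exists_inner_cyclicOrbit_eq A Z
      (f ∘ₗ LinearMap.mulLeft ℂ (star x)) ‖cyclicOrbit A Z x‖ (hb x)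
    exact ⟨p, by simpa using h1, h2⟩
  choose p hp1 hp2 using hp
  let P : A →ₗ[ℂ] cyclicSubspace A Z :=
    { toFun := p
      map_add' := fun x y => cyclicSubspace_ext fun z => by
        rw [inner_add_left, hp2, hp2, hp2, star_add, add_mul, map_add]
      map_smul' := fun c x => cyclicSubspace_ext fun z => by
        rw [RingHom.id_apply, inner_smul_left, hp2, hp2, star_smul_vN, smul_mul_assoc, map_smul]
        rfl }
  refine ⟨P.extendOfNorm (cyclicOrbit A Z), fun x y => ?_⟩
  rw [LinearMap.extendOfNorm_eq (denseRange_cyclicOrbit A Z) ⟨1, fun x => by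
    rw [one_mul]; exact hp1 x⟩]
  exact hp2 x y

theorem IsPosOn.exists_vector {f : A →ₗ[ℂ] ℂ} (hf : IsPosOn A f) (Z : Ell2 K)
    (h : ∀ x, (f (star x * x)).re ≤ ‖cyclicOrbit A Z x‖ ^ 2) :
    ∃ w : Ell2 K, ∀ x : A, f x = ⟪w, amp (x : K →L[ℂ] K) w⟫_ℂ := by
  obtain ⟨t, ht⟩ := hf.exists_operator Z h
  have hpos : 0 ≤ t := by
    rw [ContinuousLinearMap.nonneg_iff_isPositive, ContinuousLinearMap.isPositive_iff_complex]
    suffices H : ∀ v, 0 ≤ ⟪t v, v⟫_ℂ from fun v =>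
      ⟨(Complex.ext (by simp) (by simpa using (Complex.nonneg_iff.mp (H v)).2)),
        (Complex.nonneg_iff.mp (H v)).1⟩
    refine fun v => (denseRange_cyclicOrbit A Z).induction_on (p := fun v => 0 ≤ ⟪t v, v⟫_ℂ) v
      ?_ ?_
    · exact isClosed_le continuous_const (by fun_prop)
    · intro x
      rw [ht]
      exact hf x
  have hcomm : ∀ x, Commute t (cyclicRep A Z x) := fun x => by
    refine ContinuousLinearMap.ext fun v => ?_
    refine (denseRange_cyclicOrbit A Z).induction_on
      (p := fun v => (t * cyclicRep A Z x) v = (cyclicRep A Z x * t) v) v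
      (isClosed_eq (by fun_prop) (by fun_prop)) fun y => cyclicSubspace_ext fun z => ?_
    change ⟪t (cyclicRep A Z x (cyclicOrbit A Z y)), cyclicOrbit A Z z⟫_ℂ =
      ⟪cyclicRep A Z x (t (cyclicOrbit A Z y)), cyclicOrbit A Z z⟫_ℂ
    rw [inner_cyclicRep_left, cyclicRep_cyclicOrbit, cyclicRep_cyclicOrbit, ht, ht, StarMul.star_mul,
      mul_assoc]
  obtain ⟨s, hsa, hss, hsc⟩ := exists_selfAdjoint_sqrt (E := cyclicSubspace A Z) hpos
  refine ⟨(s (cyclicOrbit A Z 1) : cyclicSubspace A Z), fun x => ?_⟩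
  have hsx : s * cyclicRep A Z x = cyclicRep A Z x * s := hsc _ (hcomm x)
  have h1 : f x = ⟪t (cyclicOrbit A Z 1), cyclicOrbit A Z x⟫_ℂ := by rw [ht, star_one, one_mul]
  have h2 : cyclicOrbit A Z x = cyclicRep A Z x (cyclicOrbit A Z 1) := by
    rw [cyclicRep_cyclicOrbit, mul_one]
  rw [h1, h2, ← hss]
  calc ⟪s (s (cyclicOrbit A Z 1)), cyclicRep A Z x (cyclicOrbit A Z 1)⟫_ℂ
      = ⟪s (cyclicOrbit A Z 1), (s * cyclicRep A Z x) (cyclicOrbit A Z 1)⟫_ℂ := by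
        rw [← ContinuousLinearMap.adjoint_inner_right, ← ContinuousLinearMap.star_eq_adjoint,
          hsa.star_eq]
        rfl
    _ = _ := by
        rw [hsx]
        rfl

/-- A positive functional dominated by a countable sum of vector functionals is normal. -/
theorem IsPosOn.isNormalOn {f : A →ₗ[ℂ] ℂ} (hf : IsPosOn A f) {ζ : ℕ → K}
    (hζ : Summable fun k => ‖ζ k‖ ^ 2)
    (h : ∀ x : A, (f (star x * x)).re ≤ ∑' k, ‖(x : K →L[ℂ] K) (ζ k)‖ ^ 2) : IsNormalOn A f := by
  obtain ⟨w, hw⟩ := hf.exists_vector (Ell2.mk ζ hζ) fun x => (h x).trans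
    (Ell2.hasSum_norm_sq (orbit A (Ell2.mk ζ hζ) x)).tsum_eq.le
  refine ⟨w, (Ell2.hasSum_norm_sq w).summable, fun x => ?_⟩
  rw [hw]
  exact hasSum_inner_amp _ _ _

/-- The vector of `ℓ²` attached to a normal functional. -/
theorem IsNormalOn.exists_vector {f : A →ₗ[ℂ] ℂ} (hf : IsNormalOn A f) :
    ∃ Z : Ell2 K, ∀ x, f x = ⟪Z, orbit A Z x⟫_ℂ := by
  obtain ⟨ξ, hξ, h⟩ := hf
  exact ⟨Ell2.mk ξ hξ, fun x => (h x).unique (hasSum_inner_amp _ (Ell2.mk ξ hξ) (Ell2.mk ξ hξ))⟩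

theorem re_star_mul_self_eq {f : A →ₗ[ℂ] ℂ} {Z : Ell2 K} (hZ : ∀ x, f x = ⟪Z, orbit A Z x⟫_ℂ)
    (x : A) : (f (star x * x)).re = ‖cyclicOrbit A Z x‖ ^ 2 := by
  rw [hZ, norm_sq_cyclicOrbit]

theorem IsNormalOn.isPosOn {f : A →ₗ[ℂ] ℂ} (hf : IsNormalOn A f) : IsPosOn A f := by
  obtain ⟨Z, hZ⟩ := hf.exists_vector
  intro x
  rw [hZ, ← inner_orbit, inner_self_eq_norm_sq_to_K, ← RCLike.ofReal_pow]
  exact Complex.zero_le_real.mpr (sq_nonneg _)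

end Domination

section Density

variable {H : Type} [NormedAddCommGroup H] [InnerProductSpace ℂ H] [CompleteSpace H]
  {M : VonNeumannAlgebra H}

/-- The vectors representing a faithful normal functional are cyclic for the commutant. -/
theorem eq_top_of_forall_commutant_apply_mem {τ : M →ₗ[ℂ] ℂ} (hf : IsFaithfulOn M τ) {Ξ : Ell2 H}
    (hΞ : ∀ x, τ x = ⟪Ξ, orbit M Ξ x⟫_ℂ) {X : Submodule ℂ H} (hX : IsClosed (X : Set H))
    (h : ∀ a ∈ M.commutant, ∀ k, a (Ξ k) ∈ X) : X = ⊤ := by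
  set S : Set H := {v | ∃ a ∈ M.commutant, ∃ k, v = a (Ξ k)} with hS
  set Y : Submodule ℂ H := (Submodule.span ℂ S).topologicalClosure with hY
  have hYc : IsClosed (Y : Set H) := Submodule.isClosed_topologicalClosure _
  have : CompleteSpace Y := hYc.completeSpace_coe
  have hYX : Y ≤ X := by
    refine Submodule.topologicalClosure_minimal _ (Submodule.span_le.mpr ?_) hX
    rintro _ ⟨a, ha, k, rfl⟩
    exact h a ha k
  have hSY : S ⊆ Y := fun v hv => Submodule.le_topologicalClosure _ (Submodule.subset_span hv)
  have he : Y.starProjection ∈ M := by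
    rw [VonNeumannAlgebra.IsStarProjection.mem_iff isStarProjection_starProjection]
    intro b hb
    rw [Submodule.range_starProjection, Module.End.mem_invtSubmodule_iff_forall_mem_of_mem]
    intro v hv
    refine map_mem_closure (t := (Submodule.span ℂ S : Set H)) b.continuous hv fun w hw => ?_
    have : Submodule.span ℂ S ≤ (Submodule.span ℂ S).comap (b : H →ₗ[ℂ] H) := by
      rw [Submodule.span_le]
      rintro _ ⟨a, ha, k, rfl⟩
      exact Submodule.subset_span ⟨b * a, mul_mem hb ha, k, rfl⟩
    exact this hw
  have h0 : orbit M Ξ (1 - ⟨Y.starProjection, he⟩) = 0 := by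
    ext k
    have hk : Y.starProjection (Ξ k) = Ξ k :=
      Submodule.starProjection_eq_self_iff.mpr
        (hSY ⟨1, one_mem _, k, rfl⟩)
    simp [orbit_apply, hk]
  have h1 : (1 : M) - ⟨Y.starProjection, he⟩ = 0 := by
    refine hf _ ?_
    rw [hΞ, ← inner_orbit, h0, inner_zero_left]
  have h2 : Y.starProjection = 1 := (congrArg Subtype.val (sub_eq_zero.mp h1)).symm
  rw [eq_top_iff]
  intro v _
  refine hYX (Submodule.starProjection_eq_self_iff.mp ?_)
  rw [h2]
  rfl

/-- The submodule of vectors on which a bounded sequence of operators converges. -/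
def limitSubmodule (x : ℕ → H →L[ℂ] H) : Submodule ℂ H where
  carrier := {w | ∃ l, Tendsto (fun n => x n w) atTop (𝓝 l)}
  zero_mem' := ⟨0, by simp⟩
  add_mem' := by
    rintro v w ⟨l, hl⟩ ⟨m, hm⟩
    exact ⟨l + m, by simpa using hl.add hm⟩
  smul_mem' := by
    rintro c w ⟨l, hl⟩
    exact ⟨c • l, by simpa using hl.const_smul c⟩

theorem isClosed_limitSubmodule {x : ℕ → H →L[ℂ] H} (hx : ∀ n, ‖x n‖ ≤ 1) :
    IsClosed (limitSubmodule x : Set H) := by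
  refine isClosed_of_closure_subset fun w hw => ?_
  refine cauchySeq_tendsto_of_complete (Metric.cauchySeq_iff.mpr fun ε hε => ?_)
  obtain ⟨v, ⟨l, hl⟩, hv⟩ := Metric.mem_closure_iff.mp hw (ε / 3) (by positivity)
  obtain ⟨N, hN⟩ := Metric.cauchySeq_iff.mp hl.cauchySeq (ε / 3) (by positivity)
  refine ⟨N, fun m hm n hn => ?_⟩
  have hc : ∀ k, dist (x k w) (x k v) ≤ dist w v := fun k => by
    rw [dist_eq_norm, dist_eq_norm, ← map_sub]
    exact (x k).le_of_opNorm_le (hx k) _ |>.trans (one_mul _).le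
  have h1 := dist_triangle4 (x m w) (x m v) (x n v) (x n w)
  have h2 := hc m
  have h3 := hc n
  rw [dist_comm] at h3
  have h4 := hN m hm n hn
  linarith

/-- The unit interval of `M` is closed in the norm given by a faithful normal functional. -/
theorem exists_orbit_eq_of_tendsto {τ : M →ₗ[ℂ] ℂ} (hf : IsFaithfulOn M τ) {Ξ : Ell2 H}
    (hΞ : ∀ x, τ x = ⟪Ξ, orbit M Ξ x⟫_ℂ) {x : ℕ → M} (h0 : ∀ n, 0 ≤ (x n : H →L[ℂ] H))
    (h1 : ∀ n, (x n : H →L[ℂ] H) ≤ 1) {p : Ell2 H}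
    (hp : Tendsto (fun n => orbit M Ξ (x n)) atTop (𝓝 p)) :
    ∃ h : M, 0 ≤ (h : H →L[ℂ] H) ∧ (h : H →L[ℂ] H) ≤ 1 ∧ orbit M Ξ h = p := by
  have hn : ∀ n, ‖(x n : H →L[ℂ] H)‖ ≤ 1 := fun n =>
    (CStarAlgebra.norm_le_one_iff_of_nonneg _ (h0 n)).mpr (h1 n)
  have hpk : ∀ k, Tendsto (fun n => (x n : H →L[ℂ] H) (Ξ k)) atTop (𝓝 (p k)) := fun k =>
    ((lp.evalCLM ℂ (fun _ : ℕ => H) 2 k).continuous.tendsto p).comp hp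
  have hXtop : limitSubmodule (fun n => (x n : H →L[ℂ] H)) = ⊤ := by
    refine eq_top_of_forall_commutant_apply_mem hf hΞ (isClosed_limitSubmodule hn) ?_
    intro a ha k
    refine ⟨a (p k), ?_⟩
    have := (a.continuous.tendsto (p k)).comp (hpk k)
    refine this.congr fun n => ?_
    have hc := VonNeumannAlgebra.mem_commutant_iff.mp ha _ (x n).2
    exact (congrArg (fun T : H →L[ℂ] H => T (Ξ k)) hc).symm
  have hlim : ∀ w, ∃ l, Tendsto (fun n => (x n : H →L[ℂ] H) w) atTop (𝓝 l) := fun w => by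
    have : w ∈ limitSubmodule (fun n => (x n : H →L[ℂ] H)) := hXtop ▸ Submodule.mem_top
    exact this
  choose f hf' using hlim
  let h : H →L[ℂ] H := continuousLinearMapOfTendsto (fun n => (x n : H →L[ℂ] H))
    (tendsto_pi_nhds.mpr hf')
  have hh : ∀ w, Tendsto (fun n => (x n : H →L[ℂ] H) w) atTop (𝓝 (h w)) := hf'
  have hmem : h ∈ M := by
    refine mem_of_commute _ fun b hb => ContinuousLinearMap.ext fun w => ?_
    refine tendsto_nhds_unique ((b.continuous.tendsto _).comp (hh w)) ((hh (b w)).congr fun n => ?_)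
    have hc := VonNeumannAlgebra.mem_commutant_iff.mp hb _ (x n).2
    exact congrArg (fun T : H →L[ℂ] H => T w) hc
  have hnonneg : ∀ {y : ℕ → H →L[ℂ] H} {l : H →L[ℂ] H}, (∀ n, 0 ≤ y n) →
      (∀ w, Tendsto (fun n => y n w) atTop (𝓝 (l w))) → 0 ≤ l := fun {y l} hy hl => by
    rw [ContinuousLinearMap.nonneg_iff_isPositive, ContinuousLinearMap.isPositive_iff_complex]
    suffices H : ∀ v, 0 ≤ ⟪l v, v⟫_ℂ from fun v =>
      ⟨(Complex.ext (by simp) (by simpa using (Complex.nonneg_iff.mp (H v)).2)),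
        (Complex.nonneg_iff.mp (H v)).1⟩
    intro v
    refine ge_of_tendsto' ((hl v).inner tendsto_const_nhds) fun n => ?_
    have := (ContinuousLinearMap.nonneg_iff_isPositive _).mp (hy n)
    exact this.inner_nonneg_left v
  refine ⟨⟨h, hmem⟩, hnonneg h0 hh, ?_, ?_⟩
  · rw [← sub_nonneg]
    refine hnonneg (y := fun n => 1 - (x n : H →L[ℂ] H)) (fun n => sub_nonneg.mpr (h1 n)) fun w => ?_
    exact (tendsto_const_nhds (x := w)).sub (hh w)
  · ext k
    exact tendsto_nhds_unique (hh (Ξ k)) (hpk k)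

end Density

section RadonNikodym

variable {H : Type} [NormedAddCommGroup H] [InnerProductSpace ℂ H] [CompleteSpace H]
  {M : VonNeumannAlgebra H}

theorem IsPosOn.re_le {f : M →ₗ[ℂ] ℂ} (hf : IsPosOn M f) {x y : M}
    (hxy : (x : H →L[ℂ] H) ≤ y) : (f x).re ≤ (f y).re := by
  have h := (Complex.nonneg_iff.mp (hf.nonneg (y - x) (sub_nonneg.mpr hxy))).1
  rw [map_sub, Complex.sub_re] at h
  linarith

theorem re_le_of_nonneg {f g : M →ₗ[ℂ] ℂ}
    (hle : ∀ x, (f (star x * x)).re ≤ (g (star x * x)).re) {x : M} (hx : 0 ≤ (x : H →L[ℂ] H)) :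
    (f x).re ≤ (g x).re := by
  obtain ⟨w, -, rfl⟩ := exists_star_mul_self_of_nonneg x hx
  exact hle w

/-- An approximate spectral projection on the positive part of a selfadjoint operator. -/
theorem exists_approx_positive_projection {T : H →L[ℂ] H} (hT : IsSelfAdjoint T) {η : ℝ}
    (hη : 0 < η) : ∃ g q : ℝ → ℝ, 0 ≤ cfc g T ∧ cfc g T ≤ 1 ∧ 0 ≤ cfc q T ∧ T ≤ cfc q T ∧
      cfc q T ≤ T * cfc g T + (η : ℂ) • (1 : H →L[ℂ] H) := by
  have hpos : ∀ t : ℝ, 0 < max t 0 + η := fun t => add_pos_of_nonneg_of_pos (le_max_right _ _) hη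
  have hg : Continuous fun t : ℝ => max t 0 / (max t 0 + η) :=
    Continuous.div (by fun_prop) (by fun_prop) fun t => (hpos t).ne'
  have hq : Continuous fun t : ℝ => max t 0 := by fun_prop
  refine ⟨fun t => max t 0 / (max t 0 + η), fun t => max t 0, ?_, ?_, ?_, ?_, ?_⟩
  · exact cfc_nonneg fun t _ => div_nonneg (le_max_right _ _) (hpos t).le
  · exact cfc_le_one _ _ fun t _ => (div_le_one (hpos t)).mpr (by linarith)
  · exact cfc_nonneg fun t _ => le_max_right _ _
  · conv_lhs => rw [← cfc_id' ℝ T]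
    exact cfc_mono (fun t _ => le_max_left _ _) (by fun_prop) hq.continuousOn
  · have h1 : T * cfc (fun t : ℝ => max t 0 / (max t 0 + η)) T + (η : ℂ) • (1 : H →L[ℂ] H)
        = cfc (fun t : ℝ => t * (max t 0 / (max t 0 + η)) + η) T := by
      rw [cfc_add_const η (fun t : ℝ => t * (max t 0 / (max t 0 + η))) T
        (continuous_id.mul hg).continuousOn, cfc_mul (fun t : ℝ => t) _ T (by fun_prop)
        hg.continuousOn, cfc_id' ℝ T, Algebra.algebraMap_eq_smul_one]
      rfl
    rw [h1]
    refine cfc_mono (fun t _ => ?_) hq.continuousOn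
      ((continuous_id.mul hg).add continuous_const).continuousOn
    rcases le_total t 0 with ht | ht
    · simp [ht, hη.le]
    · simp only [max_eq_left ht]
      have : t * (t / (t + η)) + η - t = η ^ 2 / (t + η) := by
        have : t + η ≠ 0 := by positivity
        field_simp
        ring
      have : 0 ≤ η ^ 2 / (t + η) := by positivity
      linarith

/-- If `φ ≤ τ`, then `φ(z)` is at most the supremum of `τ(zh)` over `0 ≤ h ≤ 1`. -/
theorem exists_re_lt {τ φ : M →ₗ[ℂ] ℂ} (hτ : IsPosOn M τ) (hτ1 : τ 1 = 1) (hφ : IsPosOn M φ)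
    (hle : ∀ x, (φ (star x * x)).re ≤ (τ (star x * x)).re) {z : M} (hz : star z = z) {δ : ℝ}
    (hδ : 0 < δ) : ∃ h : M, 0 ≤ (h : H →L[ℂ] H) ∧ (h : H →L[ℂ] H) ≤ 1 ∧
      (φ z).re < (τ (z * h)).re + δ := by
  have hz' : IsSelfAdjoint (z : H →L[ℂ] H) := congrArg Subtype.val hz
  obtain ⟨g, q, hg0, hg1, hq0, hzq, hqg⟩ := exists_approx_positive_projection hz' (half_pos hδ)
  let F : M := ⟨cfc g (z : H →L[ℂ] H), cfc_mem z.2 g⟩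
  let P : M := ⟨cfc q (z : H →L[ℂ] H), cfc_mem z.2 q⟩
  refine ⟨F, hg0, hg1, ?_⟩
  have h1 : (φ z).re ≤ (φ P).re := hφ.re_le hzq
  have h2 : (φ P).re ≤ (τ P).re := re_le_of_nonneg hle hq0
  have h3 : (τ P).re ≤ (τ (z * F + ((δ / 2 : ℝ) : ℂ) • (1 : M))).re := hτ.re_le hqg
  rw [map_add, map_smul, hτ1, Complex.add_re, smul_eq_mul, mul_one, Complex.ofReal_re] at h3
  linarith

theorem norm_orbit_le {Ξ : Ell2 H} {h : M} (hn : ‖(h : H →L[ℂ] H)‖ ≤ 1) :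
    ‖orbit M Ξ h‖ ≤ ‖Ξ‖ := by
  rw [orbit_apply]
  refine ((amp (h : H →L[ℂ] H)).le_of_opNorm_le
    (LinearMap.mkContinuous_norm_le _ (norm_nonneg _) _) Ξ).trans ?_
  exact mul_le_of_le_one_left (norm_nonneg _) hn

/-- The unit interval of a von Neumann algebra. -/
def unitIntervalOf (M : VonNeumannAlgebra H) : Set M :=
  {h | 0 ≤ (h : H →L[ℂ] H) ∧ (h : H →L[ℂ] H) ≤ 1}

theorem star_eq_of_mem_unitIntervalOf {h : M} (hh : h ∈ unitIntervalOf M) : star h = h :=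
  Subtype.ext (IsSelfAdjoint.of_nonneg hh.1).star_eq

theorem convex_image_unitIntervalOf (Ξ : Ell2 H) :
    Convex ℝ (cyclicOrbit M Ξ '' unitIntervalOf M) := by
  rintro _ ⟨x, hx, rfl⟩ _ ⟨y, hy, rfl⟩ a b ha hb hab
  refine ⟨(a : ℂ) • x + (b : ℂ) • y, ⟨?_, ?_⟩, ?_⟩
  · change 0 ≤ a • (x : H →L[ℂ] H) + b • (y : H →L[ℂ] H)
    exact add_nonneg (smul_nonneg ha hx.1) (smul_nonneg hb hy.1)
  · change a • (x : H →L[ℂ] H) + b • (y : H →L[ℂ] H) ≤ 1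
    calc a • (x : H →L[ℂ] H) + b • (y : H →L[ℂ] H)
        ≤ a • (1 : H →L[ℂ] H) + b • (1 : H →L[ℂ] H) :=
          add_le_add (smul_le_smul_of_nonneg_left hx.2 ha) (smul_le_smul_of_nonneg_left hy.2 hb)
      _ = 1 := by rw [← add_smul, hab, one_smul]
  · rw [map_add, map_smul, map_smul]
    rfl

theorem isClosed_image_unitIntervalOf {τ : M →ₗ[ℂ] ℂ} (hf : IsFaithfulOn M τ) {Ξ : Ell2 H}
    (hΞ : ∀ x, τ x = ⟪Ξ, orbit M Ξ x⟫_ℂ) :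
    IsClosed (cyclicOrbit M Ξ '' unitIntervalOf M) := by
  refine IsSeqClosed.isClosed fun x p hx hp => ?_
  choose h hh hhx using hx
  obtain ⟨l, hl0, hl1, hl⟩ := exists_orbit_eq_of_tendsto hf hΞ (fun n => (hh n).1)
    (fun n => (hh n).2) (p := p) (((continuous_subtype_val.tendsto p).comp hp).congr fun n => by
      rw [Function.comp_apply, ← hhx]
      rfl)
  exact ⟨l, ⟨hl0, hl1⟩, Subtype.ext hl⟩

/-- The Radon-Nikodym theorem for functionals dominated by a faithful normal tracial state. -/
theorem exists_radonNikodym {τ φ : M →ₗ[ℂ] ℂ} (hτn : IsNormalOn M τ) (hτ1 : τ 1 = 1)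
    (hτf : IsFaithfulOn M τ) (hτt : IsTracialOn M τ) (hφ : IsPosOn M φ)
    (hle : ∀ x, (φ (star x * x)).re ≤ (τ (star x * x)).re) :
    ∃ h ∈ unitIntervalOf M, ∀ x, φ x = τ (h * x) := by
  have hτ := hτn.isPosOn
  obtain ⟨Ξ, hΞ⟩ := hτn.exists_vector
  have hns : ∀ x, (τ (star x * x)).re = ‖cyclicOrbit M Ξ x‖ ^ 2 := re_star_mul_self_eq hΞ
  have hb : ∀ x, ‖φ x‖ ≤ ‖cyclicOrbit M Ξ 1‖ * ‖cyclicOrbit M Ξ x‖ := fun x => by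
    refine le_of_sq_le_sq ?_ (by positivity)
    have h := hφ.cauchy_schwarz 1 x
    rw [star_one, one_mul] at h
    rw [mul_pow, ← hns, ← hns]
    refine h.trans (mul_le_mul ?_ (hle x) (Complex.nonneg_iff.mp (hφ x)).1 ?_)
    · simpa using hle 1
    · exact (Complex.nonneg_iff.mp (hτ 1)).1
  obtain ⟨p, -, hp⟩ := exists_inner_cyclicOrbit_eq M Ξ φ _ hb
  by_cases hpS : p ∈ cyclicOrbit M Ξ '' unitIntervalOf M
  · obtain ⟨h, hh, rfl⟩ := hpS
    refine ⟨h, hh, fun x => ?_⟩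
    rw [← hp, inner_cyclicOrbit, ← hΞ, star_eq_of_mem_unitIntervalOf hh]
  · exfalso
    obtain ⟨f, u, hfS, hfp⟩ := RCLike.geometric_hahn_banach_closed_point (𝕜 := ℂ)
      (convex_image_unitIntervalOf Ξ) (isClosed_image_unitIntervalOf hτf hΞ) hpS
    set k := (InnerProductSpace.toDual ℂ (cyclicSubspace M Ξ)).symm f with hk
    have hfk : ∀ v, f v = ⟪k, v⟫_ℂ := fun v => by
      rw [hk, InnerProductSpace.toDual_symm_apply]
    set δ := (f p).re - u with hδ
    have hδ0 : 0 < δ := sub_pos.mpr hfp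
    set R := ‖Ξ‖ + ‖p‖ + 1 with hR
    have hR0 : 0 < R := by positivity
    obtain ⟨y, hy⟩ := (denseRange_cyclicOrbit M Ξ).exists_dist_lt k
      (show 0 < δ / 4 / R by positivity)
    have hclose : ∀ v : cyclicSubspace M Ξ, ‖v‖ ≤ R →
        |(f v).re - (⟪cyclicOrbit M Ξ y, v⟫_ℂ).re| ≤ δ / 4 := fun v hv => by
      rw [hfk, ← Complex.sub_re, ← inner_sub_left (𝕜 := ℂ) k (cyclicOrbit M Ξ y) v]
      refine (Complex.abs_re_le_norm _).trans ((norm_inner_le_norm _ _).trans ?_)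
      rw [dist_eq_norm] at hy
      calc ‖k - cyclicOrbit M Ξ y‖ * ‖v‖ ≤ δ / 4 / R * R := by gcongr
        _ = δ / 4 := by field_simp
    set z : M := (1 / 2 : ℂ) • (y + star y) with hz
    have hzs : star z = z := by
      rw [hz, star_smul_vN, star_add, star_star, add_comm (star y)]
      simp
    obtain ⟨h, hh0, hh1, hh⟩ := exists_re_lt hτ hτ1 hφ hle hzs (half_pos hδ0)
    have e1 : (φ z).re = (⟪cyclicOrbit M Ξ y, p⟫_ℂ).re := by
      rw [← inner_conj_symm (𝕜 := ℂ) (cyclicOrbit M Ξ y) p, hp, hz, map_smul, map_add, hφ.map_star]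
      simp
      ring
    have e2 : (τ (z * h)).re = (⟪cyclicOrbit M Ξ y, cyclicOrbit M Ξ h⟫_ℂ).re := by
      rw [inner_cyclicOrbit, ← hΞ, hz, smul_mul_assoc, map_smul, add_mul, map_add]
      have : τ (y * h) = star (τ (star y * h)) := by
        rw [← hτ.map_star, star_mul, star_star, star_eq_of_mem_unitIntervalOf ⟨hh0, hh1⟩, hτt]
      rw [this]
      simp
      ring
    have c1 := abs_le.mp (hclose p (by rw [hR]; linarith [norm_nonneg Ξ]))
    have hnh : ‖cyclicOrbit M Ξ h‖ ≤ ‖Ξ‖ :=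
      norm_orbit_le ((CStarAlgebra.norm_le_one_iff_of_nonneg _ hh0).mpr hh1)
    have c2 := abs_le.mp (hclose (cyclicOrbit M Ξ h) (by rw [hR]; linarith [norm_nonneg p]))
    have c3 : (f (cyclicOrbit M Ξ h)).re < u := hfS _ ⟨h, ⟨hh0, hh1⟩, rfl⟩
    rw [e1, e2] at hh
    linarith [c1.1, c1.2, c2.1, c2.2]

end RadonNikodym

section UnitInterval

variable {K : Type} [NormedAddCommGroup K] [InnerProductSpace ℂ K] [CompleteSpace K]
  {A : VonNeumannAlgebra K}

theorem coe_star_mul_self_nonneg (T : A) : 0 ≤ ((star T * T : A) : K →L[ℂ] K) :=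
  star_mul_self_nonneg (T : K →L[ℂ] K)

/-- Every positive operator is a scalar multiple of an element of the unit interval. -/
theorem exists_smul_mem_unitIntervalOf {S : A} (hS : 0 ≤ (S : K →L[ℂ] K)) :
    ∃ c : ℝ, 0 ≤ c ∧ ∃ T ∈ unitIntervalOf A, S = (c : ℂ) • T := by
  set c : ℝ := ‖(S : K →L[ℂ] K)‖ + 1 with hc
  have hc0 : 0 < c := by positivity
  refine ⟨c, hc0.le, ((c⁻¹ : ℝ) : ℂ) • S, ⟨?_, ?_⟩, ?_⟩
  · exact smul_nonneg (Complex.zero_le_real.mpr (inv_nonneg.mpr hc0.le)) hS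
  · have h1 : (0 : K →L[ℂ] K) ≤ c⁻¹ • (S : K →L[ℂ] K) := smul_nonneg (inv_nonneg.mpr hc0.le) hS
    change c⁻¹ • (S : K →L[ℂ] K) ≤ 1
    rw [← CStarAlgebra.norm_le_one_iff_of_nonneg _ h1, norm_smul, Real.norm_of_nonneg
      (inv_nonneg.mpr hc0.le), inv_mul_le_one₀ hc0]
    linarith
  · rw [smul_smul_vN, ← Complex.ofReal_mul, mul_inv_cancel₀ hc0.ne', Complex.ofReal_one, one_smul]

/-- A von Neumann algebra is the linear span of its unit interval. -/
theorem span_unitIntervalOf : Submodule.span ℂ (unitIntervalOf A) = ⊤ := by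
  have h1 : ∀ S : A, 0 ≤ (S : K →L[ℂ] K) → S ∈ Submodule.span ℂ (unitIntervalOf A) :=
    fun S hS => by
      obtain ⟨c, -, T, hT, rfl⟩ := exists_smul_mem_unitIntervalOf hS
      exact Submodule.smul_mem _ _ (Submodule.subset_span hT)
  have h2 : ∀ S : A, star S = S → S ∈ Submodule.span ℂ (unitIntervalOf A) := fun S hS => by
    have hS' : IsSelfAdjoint (S : K →L[ℂ] K) := congrArg Subtype.val hS
    set c : ℂ := (‖(S : K →L[ℂ] K)‖ : ℂ) with hc
    have hp : 0 ≤ ((c • 1 + S : A) : K →L[ℂ] K) := by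
      have := hS'.neg_algebraMap_norm_le_self
      rw [Algebra.algebraMap_eq_smul_one, neg_le_iff_add_nonneg'] at this
      exact this
    have hq : 0 ≤ ((c • 1 : A) : K →L[ℂ] K) := smul_nonneg (Complex.zero_le_real.mpr (norm_nonneg _)) zero_le_one
    have : S = (c • 1 + S) - c • 1 := by abel
    rw [this]
    exact sub_mem (h1 _ hp) (h1 _ hq)
  rw [eq_top_iff]
  intro T _
  have hT : T = (1 / 2 : ℂ) • ((T + star T) + (-Complex.I) • (Complex.I • (T - star T))) := by
    rw [smul_smul_vN]
    simp only [neg_mul, Complex.I_mul_I, neg_neg, one_smul]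
    rw [show T + star T + (T - star T) = (2 : ℂ) • T by rw [two_smul]; abel, smul_smul_vN]
    norm_num
  rw [hT]
  refine Submodule.smul_mem _ _ (add_mem (h2 _ ?_) (Submodule.smul_mem _ _ (h2 _ ?_)))
  · rw [star_add, star_star, add_comm]
  · rw [star_smul_vN, star_sub, star_star]
    simp only [Complex.star_def, Complex.conj_I, neg_smul]
    rw [← smul_neg, neg_sub]

end UnitInterval

section Expectation

variable {H : Type} [NormedAddCommGroup H] [InnerProductSpace ℂ H] [CompleteSpace H]
  {M : VonNeumannAlgebra H}
  {K : Type} [NormedAddCommGroup K] [InnerProductSpace ℂ K] [CompleteSpace K]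
  {A : VonNeumannAlgebra K} {τ : M →ₗ[ℂ] ℂ} {inc : Inclusion M A} {ψ : A →ₗ[ℂ] ℂ}

theorem IsFaithfulOn.eq_of_forall_mul (hτf : IsFaithfulOn M τ) (hτt : IsTracialOn M τ) {x y : M}
    (h : ∀ z, τ (x * z) = τ (y * z)) : x = y := by
  refine sub_eq_zero.mp (hτf _ ?_)
  rw [hτt, sub_mul, map_sub, h, sub_self]

theorem IsHypertrace.apply_mul_star_mul (hψ : IsHypertrace τ inc ψ) (T : A) (x : M) :
    ψ (T * inc.π (star x * x)) = ψ (star (inc.π (star x)) * T * inc.π (star x)) := by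
  rw [inc.map_mul, ← mul_assoc, ← hψ.2, inc.map_star, star_star, mul_assoc]

theorem IsHypertrace.exists_of_mem_unitIntervalOf (hψ : IsHypertrace τ inc ψ)
    (hτn : IsNormalOn M τ) (hτ1 : τ 1 = 1) (hτf : IsFaithfulOn M τ) (hτt : IsTracialOn M τ)
    {T : A} (hT : T ∈ unitIntervalOf A) :
    ∃ h ∈ unitIntervalOf M, ∀ x, ψ (T * inc.π x) = τ (h * x) := by
  have hpos : ∀ S : A, 0 ≤ (S : K →L[ℂ] K) → ∀ x, 0 ≤ ψ (S * inc.π (star x * x)) := by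
    intro S hS x
    obtain ⟨w, -, rfl⟩ := exists_star_mul_self_of_nonneg S hS
    have := hψ.1.1.2 (w * inc.π (star x))
    rwa [star_mul, mul_assoc, ← mul_assoc (star w), ← mul_assoc, ← hψ.apply_mul_star_mul] at this
  refine exists_radonNikodym (φ := ψ ∘ₗ LinearMap.mulLeft ℂ T ∘ₗ inc.π) hτn hτ1 hτf hτt
    (hpos T hT.1) fun x => ?_
  have h := (Complex.nonneg_iff.mp (hpos (1 - T) (sub_nonneg.mpr hT.2) x)).1
  rw [sub_mul, one_mul, map_sub, hψ.1.2, Complex.sub_re] at h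
  exact sub_nonneg.mp h

/-- The map dual to a hypertrace. -/
theorem IsHypertrace.exists_linearMap (hψ : IsHypertrace τ inc ψ)
    (hτn : IsNormalOn M τ) (hτ1 : τ 1 = 1) (hτf : IsFaithfulOn M τ) (hτt : IsTracialOn M τ) :
    ∃ E : A →ₗ[ℂ] M, (∀ T x, τ (E T * x) = ψ (T * inc.π x)) ∧
      ∀ T ∈ unitIntervalOf A, E T ∈ unitIntervalOf M := by
  let G : Submodule ℂ A :=
    { carrier := {T | ∃ h, ∀ x, ψ (T * inc.π x) = τ (h * x)}
      zero_mem' := ⟨0, by simp⟩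
      add_mem' := by
        rintro S T ⟨h, hh⟩ ⟨k, hk⟩
        exact ⟨h + k, fun x => by rw [add_mul, add_mul, map_add, map_add, hh, hk]⟩
      smul_mem' := by
        rintro c T ⟨h, hh⟩
        exact ⟨c • h, fun x => by rw [smul_mul_assoc, smul_mul_assoc, map_smul, map_smul, hh]⟩ }
  have hG : ∀ T, T ∈ G := fun T => by
    have : Submodule.span ℂ (unitIntervalOf A) ≤ G := Submodule.span_le.mpr fun T hT => by
      obtain ⟨h, -, hh⟩ := hψ.exists_of_mem_unitIntervalOf hτn hτ1 hτf hτt hT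
      exact ⟨h, hh⟩
    exact this (span_unitIntervalOf (A := A) ▸ Submodule.mem_top)
  choose e he using hG
  refine ⟨{ toFun := e
            map_add' := fun S T => hτf.eq_of_forall_mul hτt fun z => ?_
            map_smul' := fun c T => hτf.eq_of_forall_mul hτt fun z => ?_ },
    fun T x => (he T x).symm, fun T hT => ?_⟩
  · rw [← he, add_mul, add_mul, map_add, map_add, he, he]
  · rw [← he, RingHom.id_apply, smul_mul_assoc, smul_mul_assoc, map_smul, map_smul, he]
  · obtain ⟨h, hh, hh'⟩ := hψ.exists_of_mem_unitIntervalOf hτn hτ1 hτf hτt hT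
    have : e T = h := hτf.eq_of_forall_mul hτt fun z => by rw [← he, hh']
    change e T ∈ _
    rwa [this]

/-- A hypertrace induces a conditional expectation. -/
theorem IsHypertrace.exists_condExp (hψ : IsHypertrace τ inc ψ)
    (hτn : IsNormalOn M τ) (hτ1 : τ 1 = 1) (hτf : IsFaithfulOn M τ) (hτt : IsTracialOn M τ) :
    ∃ CE : CondExp inc, ∀ T x, τ (CE.E T * x) = ψ (T * inc.π x) := by
  obtain ⟨E, hE, hE'⟩ := hψ.exists_linearMap hτn hτ1 hτf hτt
  refine ⟨⟨E, ?_, fun T => ?_, fun x y T => ?_, fun x => ?_⟩, hE⟩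
  · exact hτf.eq_of_forall_mul hτt fun z => by rw [hE, one_mul, one_mul, hψ.1.2]
  · obtain ⟨c, hc, S, hS, h⟩ := exists_smul_mem_unitIntervalOf (coe_star_mul_self_nonneg T)
    rw [← ContinuousLinearMap.nonneg_iff_isPositive, h, map_smul]
    exact smul_nonneg (Complex.zero_le_real.mpr hc) (hE' S hS).1
  · refine hτf.eq_of_forall_mul hτt fun z => ?_
    rw [hE, mul_assoc, mul_assoc, hψ.2, mul_assoc, mul_assoc, ← inc.map_mul, ← inc.map_mul, ← hE,
      ← mul_assoc, ← mul_assoc, hτt]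
    simp only [mul_assoc]
  · exact hτf.eq_of_forall_mul hτt fun z => by rw [hE, ← inc.map_mul, hψ.1.2]

/-- A conditional expectation composed with a trace is a hypertrace. -/
theorem CondExp.isHypertrace (CE : CondExp inc) (hτp : IsPosOn M τ) (hτ1 : τ 1 = 1)
    (hτt : IsTracialOn M τ) : IsHypertrace τ inc (τ ∘ₗ CE.E) := by
  refine ⟨⟨⟨?_, fun T => ?_⟩, fun x => ?_⟩, fun x T => ?_⟩
  · rw [LinearMap.comp_apply, CE.map_one, hτ1]
  · exact hτp.nonneg _ ((ContinuousLinearMap.nonneg_iff_isPositive _).mpr (CE.pos T))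
  · rw [LinearMap.comp_apply, CE.retract]
  · have h1 : CE.E (inc.π x * T) = x * CE.E T := by
      simpa [inc.map_one] using CE.bimod x 1 T
    have h2 : CE.E (T * inc.π x) = CE.E T * x := by
      simpa [inc.map_one] using CE.bimod 1 x T
    rw [LinearMap.comp_apply, LinearMap.comp_apply, h1, h2, hτt]

end Expectation

section Normality

variable {K : Type} [NormedAddCommGroup K] [InnerProductSpace ℂ K] [CompleteSpace K]
  {A : VonNeumannAlgebra K}

theorem sq_norm_le_of_tendsto_sum {G : Type} [NormedAddCommGroup G] [NormedSpace ℂ G]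
    {u : ℕ → G} {v : G}
    (hv : Tendsto (fun N => ∑ i ∈ Finset.range (N + 1), u i) atTop (𝓝 v)) (w : G →L[ℂ] G)
    (hs : Summable fun n => 2 * 2 ^ n * ‖w (u n)‖ ^ 2) :
    ‖w v‖ ^ 2 ≤ ∑' n, 2 * 2 ^ n * ‖w (u n)‖ ^ 2 := by
  refine le_of_tendsto' (((w.continuous.tendsto v).comp hv).norm.pow 2) fun N => ?_
  refine le_trans ?_ (hs.sum_le_tsum (Finset.range (N + 1)) fun i _ => by positivity)
  have h1 : ‖w (∑ i ∈ Finset.range (N + 1), u i)‖ ≤ ∑ i ∈ Finset.range (N + 1), ‖w (u i)‖ := by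
    rw [map_sum]
    exact norm_sum_le _ _
  have h2 := Finset.sum_sq_le_sum_mul_sum_of_sq_le_mul (Finset.range (N + 1))
    (r := fun i => ‖w (u i)‖) (f := fun i => (1 / 2 : ℝ) ^ i)
    (g := fun i => 2 ^ i * ‖w (u i)‖ ^ 2) (fun i _ => by positivity) (fun i _ => by positivity)
    fun i _ => by
      rw [← mul_assoc, ← mul_pow]
      norm_num
  have h3 := sum_geometric_two_le (N + 1)
  calc ‖w (∑ i ∈ Finset.range (N + 1), u i)‖ ^ 2
      ≤ (∑ i ∈ Finset.range (N + 1), ‖w (u i)‖) ^ 2 := by gcongr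
    _ ≤ _ := h2
    _ ≤ 2 * ∑ i ∈ Finset.range (N + 1), 2 ^ i * ‖w (u i)‖ ^ 2 := by gcongr
    _ = _ := by
      rw [Finset.mul_sum]
      exact Finset.sum_congr rfl fun i _ => by ring

/-- A positive functional dominated by a convergent series of normal functionals is normal. -/
theorem IsPosOn.isNormalOn_of_le_tsum {f : A →ₗ[ℂ] ℂ} (hf : IsPosOn A f) {g : ℕ → A →ₗ[ℂ] ℂ}
    (hg : ∀ n, IsNormalOn A (g n)) {c : ℕ → ℝ} (hc : ∀ n, 0 ≤ c n)
    (hs : Summable fun n => c n * (g n 1).re)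
    (h : ∀ T, (f (star T * T)).re ≤ ∑' n, c n * (g n (star T * T)).re) : IsNormalOn A f := by
  choose Z hZ using fun n => (hg n).exists_vector
  have hsum : ∀ (T : A) n, HasSum (fun k => ‖(T : K →L[ℂ] K) (((√(c n) : ℝ) : ℂ) • Z n k)‖ ^ 2)
      (c n * (g n (star T * T)).re) := fun T n => by
    have h1 := (Ell2.hasSum_norm_sq (orbit A (Z n) T)).mul_left (c n)
    have h2 : (g n (star T * T)).re = ‖orbit A (Z n) T‖ ^ 2 := re_star_mul_self_eq (hZ n) T
    rw [h2]
    refine h1.congr_fun fun k => ?_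
    rw [map_smul, norm_smul, mul_pow, Complex.norm_real, Real.norm_of_nonneg (Real.sqrt_nonneg _),
      Real.sq_sqrt (hc n)]
    rfl
  have hone : ∀ n, HasSum (fun k => ‖((√(c n) : ℝ) : ℂ) • Z n k‖ ^ 2) (c n * (g n 1).re) :=
    fun n => by simpa using hsum 1 n
  have hprod : Summable fun q : ℕ × ℕ => ‖((√(c q.1) : ℝ) : ℂ) • Z q.1 q.2‖ ^ 2 := by
    rw [summable_prod_of_nonneg fun _ => by positivity]
    refine ⟨fun n => (hone n).summable, ?_⟩
    simpa only [(hone _).tsum_eq] using hs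
  let ζ : ℕ → K := fun m => ((√(c (Nat.unpair m).1) : ℝ) : ℂ) • Z (Nat.unpair m).1 (Nat.unpair m).2
  have hζ : Summable fun m => ‖ζ m‖ ^ 2 := Nat.pairEquiv.symm.summable_iff.mpr hprod
  refine hf.isNormalOn hζ fun T => (h T).trans_eq ?_
  have hprodT : Summable fun q : ℕ × ℕ =>
      ‖(T : K →L[ℂ] K) (((√(c q.1) : ℝ) : ℂ) • Z q.1 q.2)‖ ^ 2 :=
    Nat.pairEquiv.symm.summable_iff.mp (summable_norm_sq_apply (T : K →L[ℂ] K) hζ)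
  have h3 := hprodT.tsum_prod
  simp only [(hsum T _).tsum_eq] at h3
  rw [← h3]
  exact (Nat.pairEquiv.symm.tsum_eq fun q : ℕ × ℕ =>
    ‖(T : K →L[ℂ] K) (((√(c q.1) : ℝ) : ℂ) • Z q.1 q.2)‖ ^ 2).symm

theorem IsPosOn.isNormalOn_of_le {f g : A →ₗ[ℂ] ℂ} (hf : IsPosOn A f) (hg : IsNormalOn A g)
    {c : ℝ} (hc : 0 ≤ c) (h : ∀ T, (f (star T * T)).re ≤ c * (g (star T * T)).re) :
    IsNormalOn A f := by
  have hsum : ∀ T, HasSum (fun n : ℕ => (if n = 0 then c else 0) * (g T).re) (c * (g T).re) :=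
    fun T => by
      have h0 : ∀ n ≠ 0, (if n = 0 then c else 0) * (g T).re = 0 := fun n hn => by
        rw [if_neg hn, zero_mul]
      simpa using hasSum_single 0 h0
  refine hf.isNormalOn_of_le_tsum (g := fun _ => g) (fun _ => hg)
    (c := fun n => if n = 0 then c else 0) (fun n => ?_) (hsum 1).summable fun T => ?_
  · split_ifs
    exacts [hc, le_rfl]
  · rw [(hsum _).tsum_eq]
    exact h T

/-- The functional `x ↦ ⟪u, x u⟫`. -/
def vecFunctional (A : VonNeumannAlgebra K) (u : K) : A →ₗ[ℂ] ℂ where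
  toFun x := ⟪u, (x : K →L[ℂ] K) u⟫_ℂ
  map_add' x y := by simp
  map_smul' c x := by simp [coe_smul_vN]

theorem vecFunctional_star_mul_self (u : K) (x : A) :
    vecFunctional A u (star x * x) = ((‖(x : K →L[ℂ] K) u‖ ^ 2 : ℝ) : ℂ) := by
  change ⟪u, ContinuousLinearMap.adjoint (x : K →L[ℂ] K) ((x : K →L[ℂ] K) u)⟫_ℂ = _
  rw [ContinuousLinearMap.adjoint_inner_right, inner_self_eq_norm_sq_to_K]
  simp

theorem vecFunctional_one (u : K) : vecFunctional A u 1 = ((‖u‖ ^ 2 : ℝ) : ℂ) := by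
  simpa using vecFunctional_star_mul_self (A := A) u 1

variable {H : Type} [NormedAddCommGroup H] [InnerProductSpace ℂ H] [CompleteSpace H]
  {M : VonNeumannAlgebra H} {τ : M →ₗ[ℂ] ℂ} {inc : Inclusion M A}

theorem CondExp.exists_star_mul_self (CE : CondExp inc) (T : A) :
    ∃ w : M, CE.E (star T * T) = star w * w := by
  obtain ⟨w, -, hw⟩ := exists_star_mul_self_of_nonneg (CE.E (star T * T))
    ((ContinuousLinearMap.nonneg_iff_isPositive _).mpr (CE.pos T))
  exact ⟨w, hw⟩

theorem CondExp.isPosOn_comp (CE : CondExp inc) {f : M →ₗ[ℂ] ℂ} (hf : IsPosOn M f) :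
    IsPosOn A (f ∘ₗ CE.E) := fun T => by
  obtain ⟨w, hw⟩ := CE.exists_star_mul_self T
  rw [LinearMap.comp_apply, hw]
  exact hf w

theorem isPosOn_vecFunctional (u : H) : IsPosOn M (vecFunctional M u) := fun x => by
  rw [vecFunctional_star_mul_self]
  exact Complex.zero_le_real.mpr (sq_nonneg _)

theorem CondExp.isNormalOn_of_tendsto_sum (CE : CondExp inc) {u : ℕ → H} {v : H}
    (hu : ∀ n, IsNormalOn A (vecFunctional M (u n) ∘ₗ CE.E))
    (hs : Summable fun n => 2 * 2 ^ n * ‖u n‖ ^ 2)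
    (hv : Tendsto (fun N => ∑ i ∈ Finset.range (N + 1), u i) atTop (𝓝 v)) :
    IsNormalOn A (vecFunctional M v ∘ₗ CE.E) := by
  refine (CE.isPosOn_comp (isPosOn_vecFunctional v)).isNormalOn_of_le_tsum hu
    (c := fun n => 2 * 2 ^ n) (fun n => by positivity) ?_ fun T => ?_
  · refine hs.congr fun n => ?_
    rw [LinearMap.comp_apply, CE.map_one, vecFunctional_one, Complex.ofReal_re]
  · obtain ⟨w, hw⟩ := CE.exists_star_mul_self T
    simp only [LinearMap.comp_apply, hw, vecFunctional_star_mul_self, Complex.ofReal_re]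
    refine sq_norm_le_of_tendsto_sum hv (w : H →L[ℂ] H) ?_
    refine Summable.of_nonneg_of_le (fun n => by positivity) (fun n => ?_)
      (hs.mul_left (‖(w : H →L[ℂ] H)‖ ^ 2))
    have := pow_le_pow_left₀ (norm_nonneg _) ((w : H →L[ℂ] H).le_opNorm (u n)) 2
    calc 2 * 2 ^ n * ‖(w : H →L[ℂ] H) (u n)‖ ^ 2
        ≤ 2 * 2 ^ n * (‖(w : H →L[ℂ] H)‖ * ‖u n‖) ^ 2 := by gcongr
      _ = _ := by ring

/-- The vectors whose vector functionals pull back to normal functionals. -/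
def CondExp.normalSubmodule (CE : CondExp inc) : Submodule ℂ H where
  carrier := {u | IsNormalOn A (vecFunctional M u ∘ₗ CE.E)}
  zero_mem' := ⟨0, by simp, fun x => by simp [vecFunctional]⟩
  add_mem' := by
    intro u v hu hv
    have hz : IsNormalOn A (vecFunctional M (0 : H) ∘ₗ CE.E) :=
      ⟨0, by simp, fun x => by simp [vecFunctional]⟩
    let s : ℕ → H := fun n => if n = 0 then u else if n = 1 then v else 0
    have hs : ∀ n, n ∉ Finset.range 2 → s n = 0 := fun n hn => by
      have : 1 < n := by simpa using hn
      simp only [s]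
      rw [if_neg (by omega), if_neg (by omega)]
    refine CE.isNormalOn_of_tendsto_sum (u := s) (fun n => ?_) ?_ ?_
    · simp only [s]
      split_ifs
      exacts [hu, hv, hz]
    · exact summable_of_ne_finset_zero (s := Finset.range 2) fun n hn => by simp [hs n hn]
    · have h := (hasSum_sum_of_ne_finset_zero hs).tendsto_sum_nat.comp (tendsto_add_atTop_nat 1)
      simpa [Function.comp_def, Finset.sum_range_succ _ 1, s] using h
  smul_mem' := by
    intro c u hu
    refine (CE.isPosOn_comp (isPosOn_vecFunctional _)).isNormalOn_of_le hu (sq_nonneg ‖c‖)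
      fun T => ?_
    obtain ⟨w, hw⟩ := CE.exists_star_mul_self T
    simp only [LinearMap.comp_apply, hw, vecFunctional_star_mul_self, Complex.ofReal_re, map_smul,
      norm_smul, mul_pow, le_refl]

theorem CondExp.isClosed_normalSubmodule (CE : CondExp inc) :
    IsClosed (CE.normalSubmodule : Set H) := by
  refine isClosed_of_closure_subset fun v hv => ?_
  obtain ⟨u, hu, hmem, -, hb⟩ := controlled_sum_of_mem_closure
    (s := CE.normalSubmodule.toAddSubgroup) hv (b := fun n => (1 / 2 : ℝ) ^ n)
    fun n => by positivity
  refine CE.isNormalOn_of_tendsto_sum hmem ?_ hu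
  rw [← summable_nat_add_iff 1]
  refine Summable.of_nonneg_of_le (fun n => by positivity) (fun n => ?_)
    ((summable_geometric_of_lt_one (r := (1 / 2 : ℝ)) (by norm_num) (by norm_num)).mul_left 1)
  have h1 := pow_le_pow_left₀ (norm_nonneg _) (hb (n + 1) n.succ_pos).le 2
  calc 2 * 2 ^ (n + 1) * ‖u (n + 1)‖ ^ 2 ≤ 2 * 2 ^ (n + 1) * ((1 / 2 : ℝ) ^ (n + 1)) ^ 2 := by
        gcongr
    _ = 1 * (1 / 2 : ℝ) ^ n := by
        have : (2 : ℝ) ^ n * (1 / 2) ^ n = 1 := by rw [← mul_pow]; norm_num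
        rw [pow_succ, pow_succ]
        linear_combination (1 / 2 : ℝ) ^ n * this

/-- A conditional expectation which composes with a faithful normal functional to a normal
functional is normal. -/
theorem CondExp.isNormal_of_comp (CE : CondExp inc) (hτn : IsNormalOn M τ)
    (hτf : IsFaithfulOn M τ) (hψ : IsNormalOn A (τ ∘ₗ CE.E)) : CE.IsNormal := by
  obtain ⟨Ξ, hΞ⟩ := hτn.exists_vector
  have htop : CE.normalSubmodule = ⊤ := by
    refine eq_top_of_forall_commutant_apply_mem hτf hΞ CE.isClosed_normalSubmodule fun a ha k => ?_
    refine (CE.isPosOn_comp (isPosOn_vecFunctional _)).isNormalOn_of_le hψ (sq_nonneg ‖a‖)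
      fun T => ?_
    obtain ⟨w, hw⟩ := CE.exists_star_mul_self T
    have h1 : (τ (star w * w)).re = ‖orbit M Ξ w‖ ^ 2 := re_star_mul_self_eq hΞ w
    have h2 : ‖(w : H →L[ℂ] H) (Ξ k)‖ ≤ ‖orbit M Ξ w‖ :=
      lp.norm_apply_le_norm (by norm_num) (orbit M Ξ w) k
    have h3 : (w : H →L[ℂ] H) (a (Ξ k)) = a ((w : H →L[ℂ] H) (Ξ k)) :=
      congrArg (fun S : H →L[ℂ] H => S (Ξ k)) (VonNeumannAlgebra.mem_commutant_iff.mp ha _ w.2)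
    simp only [LinearMap.comp_apply, hw, vecFunctional_star_mul_self, Complex.ofReal_re]
    rw [h1, h3, ← mul_pow]
    gcongr
    exact (a.le_opNorm _).trans (by gcongr)
  intro φ hφ hφn
  obtain ⟨v, hv, hφv⟩ := hφn
  refine (CE.isPosOn_comp hφ.2).isNormalOn_of_le_tsum (g := fun k => vecFunctional M (v k) ∘ₗ CE.E)
    (c := fun _ => 1) (fun k => ?_) (fun _ => zero_le_one) ?_ fun T => ?_
  · have : v k ∈ CE.normalSubmodule := htop ▸ Submodule.mem_top
    exact this
  · refine hv.congr fun k => ?_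
    rw [LinearMap.comp_apply, CE.map_one, vecFunctional_one, Complex.ofReal_re]
    rw [one_mul]
  · simp only [one_mul]
    exact (Complex.hasSum_re (hφv (CE.E (star T * T)))).tsum_eq.ge

end Normality

/-- Let `(M,τ)` be a tracial von Neumann algebra and `M ⊆ 𝒜`. There exists
an `(M,τ)`-hypertrace on `𝒜` iff there exists a conditional expectation from `𝒜` onto `M`;
and there exists a normal hypertrace on `𝒜` iff there exists a normal conditional
expectation from `𝒜` onto `M`. -/
theorem hypertrace_iff_condExp
    {H : Type} [NormedAddCommGroup H] [InnerProductSpace ℂ H] [CompleteSpace H]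
    (M : VonNeumannAlgebra H) (τ : M →ₗ[ℂ] ℂ)
    (hτ : IsStateOn M τ ∧ IsNormalOn M τ ∧ IsTracialOn M τ ∧ IsFaithfulOn M τ)
    {K : Type} [NormedAddCommGroup K] [InnerProductSpace ℂ K] [CompleteSpace K]
    (A : VonNeumannAlgebra K) (inc : Inclusion M A) :
    ((∃ ψ : A →ₗ[ℂ] ℂ, IsHypertrace τ inc ψ) ↔ Nonempty (CondExp inc)) ∧
    ((∃ ψ : A →ₗ[ℂ] ℂ, IsHypertrace τ inc ψ ∧ IsNormalOn A ψ) ↔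
      ∃ CE : CondExp inc, CE.IsNormal) := by
  obtain ⟨hτs, hτn, hτt, hτf⟩ := hτ
  refine ⟨⟨?_, ?_⟩, ?_, ?_⟩
  · rintro ⟨ψ, hψ⟩
    obtain ⟨CE, -⟩ := hψ.exists_condExp hτn hτs.1 hτf hτt
    exact ⟨CE⟩
  · rintro ⟨CE⟩
    exact ⟨_, CE.isHypertrace hτs.2 hτs.1 hτt⟩
  · rintro ⟨ψ, hψ, hψn⟩
    obtain ⟨CE, hCE⟩ := hψ.exists_condExp hτn hτs.1 hτf hτt
    have h : τ ∘ₗ CE.E = ψ := LinearMap.ext fun T => by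
      simpa [inc.map_one] using hCE T 1
    exact ⟨CE, CE.isNormal_of_comp hτn hτf (h.symm ▸ hψn)⟩
  · rintro ⟨CE, hCE⟩
    exact ⟨_, CE.isHypertrace hτs.2 hτs.1 hτt, hCE τ hτs hτn⟩

end Paper
end
end

section
/- Let (M,τ) be a tracial von Neumann algebra and φ a normal hyperstate on B(L²(M)) with associated positive trace-class operator A_φ and finite entropy H(φ) = −Tr(A_φ log A_φ) < ∞. Define G : (0,∞) → ℝ by G(t) = φ((½ A_φ + t)⁻¹ − (1+t)⁻¹). Then G is nonnegative, integrable on (0,∞), and ∫₀^∞ G(t) dt = H(φ) + log 2. -/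
open scoped InnerProductSpace ComplexOrder ENNReal
open Filter Topology

set_option synthInstance.maxHeartbeats 400000
set_option maxHeartbeats 1000000

noncomputable section

namespace Paper

section DiagonalOperators

variable {E : Type} [NormedAddCommGroup E] [InnerProductSpace ℂ E]

/-- The eigenvectors appearing in a diagonal expansion are eigenvectors. -/
theorem apply_eigenvector {A : E →L[ℂ] E} {e : ℕ → E} {a : ℕ → ℝ} (he : Orthonormal ℂ e)
    (hA : ∀ ξ : E, HasSum (fun k => ((a k : ℂ) * ⟪e k, ξ⟫_ℂ) • e k) (A ξ)) (k : ℕ) :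
    A (e k) = (a k : ℂ) • e k := by
  refine (hA (e k)).unique ?_
  convert hasSum_single (f := fun j => ((a j : ℂ) * ⟪e j, e k⟫_ℂ) • e j) k ?_ using 1
  · simp [inner_self_eq_norm_sq_to_K, he.1 k]
  · intro j hj
    simp [he.2 hj]

/-- A vector orthogonal to every vector orthogonal to an orthonormal sequence is the sum of its
Fourier series. -/
theorem hasSum_inner_smul [CompleteSpace E] {e : ℕ → E} (he : Orthonormal ℂ e) {ξ : E}
    (hξ : ∀ v : E, (∀ k, ⟪e k, v⟫_ℂ = 0) → ⟪ξ, v⟫_ℂ = 0) :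
    HasSum (fun k => ⟪e k, ξ⟫_ℂ • e k) ξ := by
  have hs : Summable fun k => ⟪e k, ξ⟫_ℂ • e k := by
    simpa using (he.orthogonalFamily.summable_iff_norm_sq_summable
      (fun k => ⟪e k, ξ⟫_ℂ)).2 (he.inner_products_summable ξ)
  obtain ⟨p, hp⟩ := hs
  have hpe : ∀ k, ⟪e k, p⟫_ℂ = ⟪e k, ξ⟫_ℂ := by
    intro k
    refine ((innerSL ℂ (e k)).hasSum hp).unique ?_
    have h := hasSum_single (f := fun j => (innerSL ℂ (e k)) (⟪e j, ξ⟫_ℂ • e j)) k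
      fun j hj => by simp [he.2 hj.symm]
    rwa [innerSL_apply_apply, inner_smul_right, inner_self_eq_norm_sq_to_K, he.1 k,
      RCLike.ofReal_one, one_pow, mul_one] at h
  have hv : ∀ k, ⟪e k, ξ - p⟫_ℂ = 0 := fun k => by rw [inner_sub_right, hpe, sub_self]
  have hpv : ⟪ξ - p, p⟫_ℂ = 0 := by
    refine ((innerSL ℂ (ξ - p)).hasSum hp).unique ?_
    simp only [innerSL_apply_apply, inner_smul_right, inner_eq_zero_symm.1 (hv _), mul_zero,
      hasSum_zero]
  have h0 : ⟪ξ - p, ξ - p⟫_ℂ = 0 := by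
    rw [inner_sub_left, hξ _ hv, inner_eq_zero_symm.1 hpv, sub_zero]
  rwa [← sub_eq_zero.1 (inner_self_eq_zero.1 h0)] at hp

/-- A normal functional with diagonal density operator evaluated at an operator which is diagonal
in the same basis. -/
theorem hasSum_normal_apply_diagonal [CompleteSpace E] {φ : (E →L[ℂ] E) →ₗ[ℂ] ℂ}
    (hφ : IsNormalB φ) {A : E →L[ℂ] E}
    (hA : ∀ ξ η : E, φ ((innerSL ℂ η).smulRight ξ) = ⟪η, A ξ⟫_ℂ)
    {e : ℕ → E} {a : ℕ → ℝ} (he : Orthonormal ℂ e)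
    (hspec : ∀ ξ : E, HasSum (fun k => ((a k : ℂ) * ⟪e k, ξ⟫_ℂ) • e k) (A ξ))
    {T : E →L[ℂ] E} {c : ℕ → ℝ} (hT : ∀ k, T (e k) = (c k : ℂ) • e k) :
    HasSum (fun k => a k * c k) (φ T).re := by
  obtain ⟨ξ, hξ, hφξ⟩ := hφ
  have hdiag : ∀ v : E, HasSum (fun n => ‖⟪v, ξ n⟫_ℂ‖ ^ 2) (⟪v, A v⟫_ℂ).re := by
    intro v
    rw [← hA v v]
    convert Complex.hasSum_re (hφξ ((innerSL ℂ v).smulRight v)) using 2 with n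
    simp only [ContinuousLinearMap.smulRight_apply, innerSL_apply_apply, inner_smul_right]
    rw [← inner_conj_symm (ξ n) v, Complex.mul_conj, Complex.ofReal_re, Complex.normSq_eq_norm_sq]
  have hexp : ∀ n, HasSum (fun k => ⟪e k, ξ n⟫_ℂ • e k) (ξ n) := by
    refine fun n => hasSum_inner_smul he fun v hv => ?_
    have hAv : A v = 0 := (hspec v).unique (by simp [hv, hasSum_zero])
    have h := hdiag v
    rw [hAv, inner_zero_right, Complex.zero_re,
      hasSum_zero_iff_of_nonneg (fun _ => by positivity)] at h
    have := congrFun h n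
    exact inner_eq_zero_symm.1 (by simpa using this)
  have hrow : ∀ {S : E →L[ℂ] E} {d : ℕ → ℝ}, (∀ k, S (e k) = (d k : ℂ) • e k) → ∀ n,
      HasSum (fun k => ‖⟪e k, ξ n⟫_ℂ‖ ^ 2 * d k) (⟪ξ n, S (ξ n)⟫_ℂ).re := by
    intro S d hS n
    have h := Complex.hasSum_re ((innerSL ℂ (ξ n)).hasSum (S.hasSum (hexp n)))
    rw [innerSL_apply_apply] at h
    convert h using 2 with k
    rw [map_smul, hS, innerSL_apply_apply, inner_smul_right, inner_smul_right,
      ← inner_conj_symm (ξ n) (e k), mul_left_comm, Complex.mul_conj, ← Complex.ofReal_mul,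
      Complex.ofReal_re, Complex.normSq_eq_norm_sq, mul_comm]
  have hone : ∀ n, HasSum (fun k => ‖⟪e k, ξ n⟫_ℂ‖ ^ 2) (‖ξ n‖ ^ 2) := by
    intro n
    have h := hrow (S := 1) (d := fun _ => 1) (by simp) n
    have h' : (⟪ξ n, ξ n⟫_ℂ).re = ‖ξ n‖ ^ 2 := inner_self_eq_norm_sq (𝕜 := ℂ) (ξ n)
    simpa [-inner_self_eq_norm_sq_to_K, h'] using h
  have hsum : Summable fun p : ℕ × ℕ => ‖⟪e p.2, ξ p.1⟫_ℂ‖ ^ 2 := by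
    refine (summable_prod_of_nonneg fun _ => by positivity).2 ⟨fun n => (hone n).summable, ?_⟩
    simpa only [(hone _).tsum_eq] using hξ
  have hc : ∀ k, ‖c k‖ ≤ ‖T‖ := by
    intro k
    have h := T.le_opNorm (e k)
    rw [hT, norm_smul, he.1 k, mul_one, mul_one, Complex.norm_real] at h
    exact h
  have hsumc : Summable fun p : ℕ × ℕ => ‖⟪e p.2, ξ p.1⟫_ℂ‖ ^ 2 * c p.2 := by
    refine Summable.of_norm_bounded (hsum.mul_right ‖T‖) fun p => ?_
    rw [norm_mul, Real.norm_of_nonneg (by positivity)]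
    exact mul_le_mul_of_nonneg_left (hc _) (by positivity)
  have htot : ∑' p : ℕ × ℕ, ‖⟪e p.2, ξ p.1⟫_ℂ‖ ^ 2 * c p.2 = (φ T).re :=
    (hsumc.hasSum.prod_fiberwise (hrow hT)).unique (Complex.hasSum_re (hφξ T))
  have hcol : ∀ k, HasSum (fun n => ‖⟪e k, ξ n⟫_ℂ‖ ^ 2 * c k) (a k * c k) := by
    intro k
    have h := hdiag (e k)
    rw [apply_eigenvector he hspec, inner_smul_right, inner_self_eq_norm_sq_to_K, he.1 k] at h
    exact HasSum.mul_right (c k) (by simpa using h)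
  have hswap := ((Equiv.prodComm ℕ ℕ).hasSum_iff.2 hsumc.hasSum).prod_fiberwise hcol
  rwa [htot] at hswap

end DiagonalOperators

section ResolventIntegral

open MeasureTheory Set

theorem hasDerivAt_log_add_sub_log_add {b t : ℝ} (hb : 0 < b) (ht : 0 ≤ t) :
    HasDerivAt (fun t => Real.log (t + b) - Real.log (t + 1)) ((b + t)⁻¹ - (1 + t)⁻¹) t := by
  have h1 := ((hasDerivAt_id t).add_const b).log (by simp; positivity)
  have h2 := ((hasDerivAt_id t).add_const 1).log (by simp; positivity)
  simpa [Pi.sub_def, add_comm] using h1.sub h2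

theorem tendsto_log_add_sub_log_add (b : ℝ) :
    Tendsto (fun t => Real.log (t + b) - Real.log (t + 1)) atTop (𝓝 0) := by
  simpa using (Real.tendsto_log_comp_add_sub_log b).sub (Real.tendsto_log_comp_add_sub_log 1)

theorem inv_add_sub_inv_add_nonneg {b t : ℝ} (hb : 0 ≤ b) (hb1 : b ≤ 1) (ht : 0 < t) :
    0 ≤ (b + t)⁻¹ - (1 + t)⁻¹ :=
  sub_nonneg.2 (inv_anti₀ (by positivity) (by gcongr))

theorem integrableOn_mul_inv_add_sub_inv_add {a : ℝ} (ha : 0 ≤ a) (ha1 : a ≤ 1) :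
    IntegrableOn (fun t => a * ((a / 2 + t)⁻¹ - (1 + t)⁻¹)) (Ioi 0) := by
  rcases ha.eq_or_lt with rfl | ha
  · simp
  · exact (integrableOn_Ioi_deriv_of_nonneg'
      (fun t ht => hasDerivAt_log_add_sub_log_add (half_pos ha) ht)
      (fun t ht => inv_add_sub_inv_add_nonneg (by positivity) (by linarith) ht)
      (tendsto_log_add_sub_log_add _)).const_mul a

theorem integral_mul_inv_add_sub_inv_add {a : ℝ} (ha : 0 ≤ a) (ha1 : a ≤ 1) :
    ∫ t in Ioi (0 : ℝ), a * ((a / 2 + t)⁻¹ - (1 + t)⁻¹)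
      = -(a * Real.log a) + a * Real.log 2 := by
  rcases ha.eq_or_lt with rfl | ha
  · simp
  · rw [integral_const_mul, integral_Ioi_of_hasDerivAt_of_nonneg'
      (fun t ht => hasDerivAt_log_add_sub_log_add (half_pos ha) ht)
      (fun t ht => inv_add_sub_inv_add_nonneg (by positivity) (by linarith) ht)
      (tendsto_log_add_sub_log_add _), zero_add, zero_add, Real.log_one,
      Real.log_div ha.ne' two_ne_zero]
    ring

/-- Termwise integration of the resolvent expansion of a probability sequence with finite
entropy. -/
theorem integral_tsum_resolvent {a : ℕ → ℝ} (ha : ∀ k, 0 ≤ a k) (ha1 : HasSum a 1)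
    (hfin : Summable fun k => a k * Real.log (a k)) :
    ∫ t in Ioi (0 : ℝ), ∑' k, a k * ((a k / 2 + t)⁻¹ - (1 + t)⁻¹)
      = -(∑' k, a k * Real.log (a k)) + Real.log 2 := by
  have hle : ∀ k, a k ≤ 1 := fun k => le_hasSum ha1 k fun j _ => ha j
  have hterm : HasSum (fun k => ∫ t in Ioi (0 : ℝ), a k * ((a k / 2 + t)⁻¹ - (1 + t)⁻¹))
      (-(∑' k, a k * Real.log (a k)) + Real.log 2) := by
    simp_rw [fun k => integral_mul_inv_add_sub_inv_add (ha k) (hle k)]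
    simpa using hfin.hasSum.neg.add (ha1.mul_right (Real.log 2))
  refine (hasSum_integral_of_summable_integral_norm
    (fun k => integrableOn_mul_inv_add_sub_inv_add (ha k) (hle k)) ?_).unique hterm
  convert hterm.summable using 2 with k
  refine setIntegral_congr_fun measurableSet_Ioi fun t ht => Real.norm_of_nonneg ?_
  exact mul_nonneg (ha k)
    (inv_add_sub_inv_add_nonneg (by linarith [ha k]) (by linarith [ha k, hle k]) ht)

end ResolventIntegral

/-- Let `φ` be a normal hyperstate on `B(L²(M))` with positive trace-class
density operator `A_φ` (with eigenvalue sequence `a` and orthonormal eigenbasis `e`) and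
finite entropy `H(φ) = -Tr(A_φ log A_φ) = -∑ₖ aₖ log aₖ < ∞`.  Then
`G(t) = φ((½A_φ + t)⁻¹ - (1+t)⁻¹)` is nonnegative and integrable on `(0,∞)`, and
`∫₀^∞ G(t) dt = H(φ) + log 2`. -/
theorem entropy_dominating_integral
    {H : Type} [NormedAddCommGroup H] [InnerProductSpace ℂ H] [CompleteSpace H]
    {M : VonNeumannAlgebra H}
    {L2M : Type} [NormedAddCommGroup L2M] [InnerProductSpace ℂ L2M] [CompleteSpace L2M]
    (τ : M →ₗ[ℂ] ℂ)
    (hτ : IsStateOn M τ ∧ IsNormalOn M τ ∧ IsTracialOn M τ ∧ IsFaithfulOn M τ)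
    (gns : GNSRep M τ L2M)
    (φ : (L2M →L[ℂ] L2M) →ₗ[ℂ] ℂ)
    (hφn : IsNormalB φ) (hφh : IsHyperstateB τ gns φ)
    (Aop : L2M →L[ℂ] L2M)
    (hAop : ∀ ξ η : L2M, φ ((innerSL ℂ η).smulRight ξ) = ⟪η, Aop ξ⟫_ℂ)
    (evec : ℕ → L2M) (a : ℕ → ℝ)
    (hON : Orthonormal ℂ evec) (ha0 : ∀ k, 0 ≤ a k)
    (hspec : ∀ ξ : L2M, HasSum (fun k => ((a k : ℂ) * ⟪evec k, ξ⟫_ℂ) • evec k) (Aop ξ))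
    (hfin : Summable fun k => a k * Real.log (a k))
    (Binv : ℝ → (L2M →L[ℂ] L2M))
    (hBinv : ∀ t : ℝ, 0 < t →
      ((2 : ℂ)⁻¹ • Aop + ((t : ℝ) : ℂ) • 1) * Binv t = 1 ∧
      Binv t * ((2 : ℂ)⁻¹ • Aop + ((t : ℝ) : ℂ) • 1) = 1) :
    (∀ t ∈ Set.Ioi (0 : ℝ), 0 ≤ (φ (Binv t - ((1 + t : ℝ) : ℂ)⁻¹ • 1)).re) ∧
    MeasureTheory.IntegrableOn (fun t => (φ (Binv t - ((1 + t : ℝ) : ℂ)⁻¹ • 1)).re)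
      (Set.Ioi 0) ∧
    ∫ t in Set.Ioi (0 : ℝ), (φ (Binv t - ((1 + t : ℝ) : ℂ)⁻¹ • 1)).re
      = (- ∑' k, a k * Real.log (a k)) + Real.log 2 := by
  have hG : ∀ t : ℝ, 0 < t → HasSum (fun k => a k * ((a k / 2 + t)⁻¹ - (1 + t)⁻¹))
      (φ (Binv t - ((1 + t : ℝ) : ℂ)⁻¹ • 1)).re := by
    refine fun t ht => hasSum_normal_apply_diagonal hφn hAop hON hspec fun k => ?_
    have hpos : 0 < a k / 2 + t := by linarith [ha0 k]
    have hfwd : ((2 : ℂ)⁻¹ • Aop + ((t : ℝ) : ℂ) • (1 : L2M →L[ℂ] L2M)) (evec k)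
        = ((a k / 2 + t : ℝ) : ℂ) • evec k := by
      simp only [add_apply, smul_apply,
        one_apply_eq_self, apply_eigenvector hON hspec, smul_smul, ← add_smul]
      congr 1
      push_cast
      ring
    have hinv := DFunLike.congr_fun (hBinv t ht).2 (evec k)
    rw [mul_apply_eq_comp, hfwd, map_smul, one_apply_eq_self] at hinv
    have hB : Binv t (evec k) = ((a k / 2 + t : ℝ) : ℂ)⁻¹ • evec k :=
      (eq_inv_smul_iff₀ (Complex.ofReal_ne_zero.2 hpos.ne')).2 hinv
    rw [sub_apply, hB, smul_apply,
      one_apply_eq_self, ← sub_smul]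
    push_cast
    rfl
  have hsum : HasSum a 1 := by
    have h := hasSum_normal_apply_diagonal hφn hAop hON hspec (T := 1) (c := fun _ => 1)
      (by simp)
    simpa [hφh.1.1] using h
  have hle : ∀ k, a k ≤ 1 := fun k => le_hasSum hsum k fun j _ => ha0 j
  have hint : ∫ t in Set.Ioi (0 : ℝ), (φ (Binv t - ((1 + t : ℝ) : ℂ)⁻¹ • 1)).re
      = (- ∑' k, a k * Real.log (a k)) + Real.log 2 := by
    rw [← integral_tsum_resolvent ha0 hsum hfin]
    exact MeasureTheory.setIntegral_congr_fun measurableSet_Ioi fun t ht => (hG t ht).tsum_eq.symm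
  refine ⟨fun t ht => (hG t ht).nonneg fun k => mul_nonneg (ha0 k)
    (inv_add_sub_inv_add_nonneg (by linarith [ha0 k]) (by linarith [ha0 k, hle k]) ht), ?_, hint⟩
  refine MeasureTheory.Integrable.of_integral_ne_zero ?_
  rw [hint]
  have hneg : ∑' k, a k * Real.log (a k) ≤ 0 :=
    tsum_nonpos fun k => Real.mul_log_nonpos (ha0 k) (hle k)
  have := Real.log_pos one_lt_two
  linarith

end Paper
end
end
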